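/- Let m, n be positive integers, d = m + n, and N a positive integer. Let ψ : [1,∞) → (0,∞) be a non-increasing continuous function with ∫_1^∞ ψ(x) dx = ∞. Then for Haar-almost every g ∈ SL_d(ℝ) the following holds: for every γ ∈ SL_d(ℤ) and every M > 0 there exists γ̃ ∈ Γ_N such that, writing gγγ̃e_1 = (v, w) with v ∈ ℝ^m and w ∈ ℝ^n, one has ‖w‖ > M and ‖v‖^m ≤ ψ(‖w‖^n). -/

import Mathlib

open Matrix MeasureTheory Set

section setup

variable (ι : Type*) [Fintype ι] [DecidableEq ι]

instance : TopologicalSpace (Matrix.SpecialLinearGroup ι ℝ) :=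
  inferInstanceAs (TopologicalSpace {A : Matrix ι ι ℝ // A.det = 1})

instance : MeasurableSpace (Matrix.SpecialLinearGroup ι ℝ) :=
  borel (Matrix.SpecialLinearGroup ι ℝ)

end setup

/-- The first standard basis vector `e₁` of `ℤ^{m+n}`. -/
def stdE1Z (m n : ℕ) : Fin m ⊕ Fin n → ℤ :=
  Sum.elim (fun i => if (i : ℕ) = 0 then 1 else 0) 0

/-- The first standard basis vector `e₁` of `ℝ^{m+n}`. -/
def stdE1R (m n : ℕ) : Fin m ⊕ Fin n → ℝ :=
  Sum.elim (fun i => if (i : ℕ) = 0 then 1 else 0) 0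

/-- An integer vector is primitive if no prime divides all its coordinates. -/
def IsPrimitiveVec {ι : Type*} (u : ι → ℤ) : Prop :=
  ∀ p : ℕ, p.Prime → ∃ i, ¬ (p : ℤ) ∣ u i

/-- Shifting `e` by a bounded multiple of `W` removes all common primes with `f` not dividing
`W`. -/
lemma exists_shift_avoiding_primes (W e f : ℤ) (hf : 0 < f) :
    ∃ t : ℤ, 0 < t ∧ t ≤ f ∧ ∀ p : ℕ, p.Prime → ¬ (p : ℤ) ∣ W → (p : ℤ) ∣ f →
      ¬ (p : ℤ) ∣ e + W * t := by
  classical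
  set S : Finset ℕ := f.natAbs.primeFactors.filter (fun p => ¬ (p : ℤ) ∣ e) with hS
  have hprime : ∀ p ∈ S, p.Prime := fun p hp =>
    Nat.prime_of_mem_primeFactors (Finset.mem_of_mem_filter p hp)
  have hf0 : f.natAbs ≠ 0 := by omega
  refine ⟨((∏ p ∈ S, p : ℕ) : ℤ), ?_, ?_, ?_⟩
  · exact_mod_cast Finset.prod_pos fun p hp => (hprime p hp).pos
  · have h1 : (∏ p ∈ S, p) ∣ ∏ p ∈ f.natAbs.primeFactors, p :=
      Finset.prod_dvd_prod_of_subset _ _ _ (Finset.filter_subset _ _)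
    have h2 := Nat.le_of_dvd (by omega) (h1.trans (Nat.prod_primeFactors_dvd f.natAbs))
    omega
  · intro p hp hpW hpf hdvd
    have hpZ : Prime (p : ℤ) := Nat.prime_iff_prime_int.mp hp
    by_cases hpe : (p : ℤ) ∣ e
    · have h1 : (p : ℤ) ∣ W * ((∏ p ∈ S, p : ℕ) : ℤ) := (dvd_add_right hpe).mp hdvd
      rcases hpZ.dvd_or_dvd h1 with h | h
      · exact hpW h
      · have h' : p ∣ ∏ p ∈ S, p := by exact_mod_cast h
        obtain ⟨q, hq, hpq⟩ := (Nat.Prime.prime hp).exists_mem_finset_dvd h'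
        have := (Nat.prime_dvd_prime_iff_eq hp (hprime q hq)).mp hpq
        subst this
        exact (Finset.mem_filter.mp hq).2 hpe
    · have hmem : p ∈ S := by
        refine Finset.mem_filter.mpr ⟨Nat.mem_primeFactors.mpr ⟨hp, ?_, hf0⟩, hpe⟩
        exact Int.natCast_dvd.mp hpf
      have h1 : (p : ℤ) ∣ ((∏ p ∈ S, p : ℕ) : ℤ) := by
        exact_mod_cast Finset.dvd_prod_of_mem _ hmem
      exact hpe ((dvd_add_left (h1.mul_left W)).mp hdvd)

/-- Inside a sublattice of index dividing a power of `J`, a primitive residue class contains a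
primitive vector whose coordinates are bounded, with one of them at least `T`. -/
lemma exists_primitive_of_sublattice {ι : Type*} [Fintype ι] [DecidableEq ι]
    (B B' : Matrix ι ι ℤ) (J : ℤ) (hJ : 0 < J)
    (hBB' : ∀ v, B.mulVec (B'.mulVec v) = J • v) (hB'B : ∀ v, B'.mulVec (B.mulVec v) = J • v)
    (N : ℕ) (hN : 0 < N) (a : ι → ℤ) (ha : IsPrimitiveVec a) (i₁ i₂ : ι) (hi : i₁ ≠ i₂) (T : ℤ) :
    ∃ u e : ι → ℤ, IsPrimitiveVec u ∧ (∀ i, u i ≡ a i [ZMOD N]) ∧ J • u = B.mulVec e ∧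
      (∀ i, i ≠ i₁ → 0 ≤ e i ∧ e i ≤ N * J ^ 2) ∧
      T ≤ e i₁ ∧ e i₁ ≤ T + N * J ^ 2 + (N * J ^ 2) ^ 2 := by
  set W : ℤ := N * J ^ 2 with hW
  have hWpos : 0 < W := by positivity
  set e₀ := B'.mulVec a with he₀
  set e₂ : ℤ := e₀ i₂ % W + (if e₀ i₂ % W = 0 then W else 0) with he₂
  have hmod : ∀ x : ℤ, 0 ≤ x % W ∧ x % W < W := fun x =>
    ⟨Int.emod_nonneg _ hWpos.ne', Int.emod_lt_of_pos _ hWpos⟩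
  have he₂pos : 0 < e₂ ∧ e₂ ≤ W := by
    have := hmod (e₀ i₂)
    rw [he₂]; split_ifs <;> omega
  obtain ⟨t, ht0, ht1, ht⟩ := exists_shift_avoiding_primes W (T + (e₀ i₁ - T) % W) e₂ he₂pos.1
  set e : ι → ℤ := fun i => if i = i₁ then T + (e₀ i₁ - T) % W + W * t else
    if i = i₂ then e₂ else e₀ i % W with he
  have hk : ∀ i, ∃ k, e i = e₀ i + W * k := by
    intro i
    simp only [he]
    split_ifs with h1 h2
    · subst h1
      exact ⟨t - (e₀ i - T) / W, by have := Int.emod_add_mul_ediv (e₀ i - T) W; linarith⟩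
    · subst h2
      have := Int.emod_add_mul_ediv (e₀ i) W
      rw [he₂]
      split_ifs
      · exact ⟨1 - (e₀ i) / W, by linarith⟩
      · exact ⟨- (e₀ i / W), by linarith⟩
    · exact ⟨- (e₀ i / W), by have := Int.emod_add_mul_ediv (e₀ i) W; linarith⟩
  choose k hk using hk
  have hek : e = e₀ + W • k := by ext i; simp [hk i]
  set u : ι → ℤ := a + (N * J : ℤ) • B.mulVec k with hu
  have hJu : J • u = B.mulVec e := by
    rw [hek, Matrix.mulVec_add, he₀, hBB', Matrix.mulVec_smul, hu, smul_add, smul_smul]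
    congr 2
    rw [hW]; ring
  have hui : ∀ i, u i = a i + N * J * B.mulVec k i := fun i => by simp [hu]
  refine ⟨u, e, ?_, ?_, hJu, ?_, ?_, ?_⟩
  · intro p hp
    by_contra! hall
    have hpZ : Prime (p : ℤ) := Nat.prime_iff_prime_int.mp hp
    by_cases hpW : (p : ℤ) ∣ W
    · have hpNJ : (p : ℤ) ∣ N * J := by
        rw [hW, pow_two, ← mul_assoc] at hpW
        rcases hpZ.dvd_or_dvd hpW with h | h
        · exact h
        · exact h.mul_left _
      obtain ⟨i, hi⟩ := ha p hp
      apply hi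
      have := hall i
      rw [hui] at this
      exact (dvd_add_left (hpNJ.mul_right _)).mp this
    · have hpJ : ¬ (p : ℤ) ∣ J := fun h =>
        hpW (by rw [hW, pow_two]; exact (h.mul_right _).mul_left _)
      choose v hv using hall
      have huv : u = (p : ℤ) • v := by ext i; simp [hv i]
      have h1 : J • e = (p : ℤ) • B'.mulVec (J • v) := by
        rw [← hB'B, ← hJu, huv, smul_comm, Matrix.mulVec_smul]
      have h2 : ∀ i, (p : ℤ) ∣ e i := by
        intro i
        have := congrFun h1 i
        simp only [Pi.smul_apply, smul_eq_mul] at this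
        have h3 : (p : ℤ) ∣ J * e i := ⟨_, this⟩
        exact (hpZ.dvd_or_dvd h3).resolve_left hpJ
      have e1 : e i₁ = T + (e₀ i₁ - T) % W + W * t := by simp [he]
      have e2 : e i₂ = e₂ := by simp [he, hi.symm]
      exact ht p hp hpW (e2 ▸ h2 i₂) (e1 ▸ h2 i₁)
  · intro i
    rw [hui]
    refine (Int.modEq_iff_dvd.mpr ⟨-(J * B.mulVec k i), by ring⟩)
  · intro i hi1
    simp only [he, if_neg hi1]
    split_ifs
    · exact ⟨he₂pos.1.le, he₂pos.2⟩
    · exact ⟨(hmod _).1, (hmod _).2.le⟩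
  · simp only [he, if_true]
    have := (hmod (e₀ i₁ - T)).1
    nlinarith
  · simp only [he, if_true]
    have := (hmod (e₀ i₁ - T)).2
    have h3 : t ≤ W := ht1.trans he₂pos.2
    nlinarith

/-- Minkowski's theorem for a unimodular lattice and a box. -/
lemma exists_int_vec_in_box {ι : Type*} [Fintype ι] [DecidableEq ι] (g : Matrix ι ι ℝ)
    (hg : g.det = 1) (b : ι → ℝ) (hb : ∀ i, 0 < b i) (hprod : 1 < ∏ i, b i) :
    ∃ z : ι → ℤ, z ≠ 0 ∧ ∀ i, |g.mulVec (fun i => (z i : ℝ)) i| < b i := by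
  set box : Set (ι → ℝ) := Set.pi univ fun i => Ioo (-b i) (b i) with hbox
  set s : Set (ι → ℝ) := (Matrix.toLin' g) ⁻¹' box with hs
  have hdet : LinearMap.det (Matrix.toLin' g) = 1 := by rw [LinearMap.det_toLin', hg]
  have hvol : volume s = ENNReal.ofReal (∏ i, (2 * b i)) := by
    rw [hs, Measure.addHaar_preimage_linearMap _ (by rw [hdet]; exact one_ne_zero), hdet, hbox,
      volume_pi_pi, ENNReal.ofReal_prod_of_nonneg fun i _ => by linarith [hb i]]
    simp only [inv_one, abs_one, ENNReal.ofReal_one, one_mul, Real.volume_Ioo]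
    exact Finset.prod_congr rfl fun i _ => by congr 1; ring
  have hconv : Convex ℝ s := by
    apply Convex.linear_preimage
    exact convex_pi fun i _ => convex_Ioo _ _
  have hsymm : ∀ x ∈ s, -x ∈ s := by
    intro x hx i hi
    have := hx i hi
    simp only [map_neg, Pi.neg_apply, mem_Ioo] at this ⊢
    constructor <;> linarith [this.1, this.2]
  let L := (Submodule.span ℤ (Set.range (Pi.basisFun ℝ ι))).toAddSubgroup
  have : Countable L := inferInstanceAs (Countable (Submodule.span ℤ (Set.range (Pi.basisFun ℝ ι))))
  obtain ⟨⟨x, hxL⟩, hx0, hxs⟩ := exists_ne_zero_mem_lattice_of_measure_mul_two_pow_lt_measure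
    (L := L) (μ := volume) (ZSpan.isAddFundamentalDomain' (Pi.basisFun ℝ ι) volume) hsymm hconv (by
      rw [ZSpan.volume_fundamentalDomain, hvol, Finset.prod_mul_distrib]
      have : (Matrix.of (Pi.basisFun ℝ ι)) = (1 : Matrix ι ι ℝ) := by
        ext i j; simp [Matrix.one_apply, Pi.single_apply, eq_comm]
      rw [this]
      simp only [det_one, abs_one, ENNReal.ofReal_one, one_mul, Finset.prod_const,
        Finset.card_univ, Module.finrank_fintype_fun_eq_card]
      rw [← ENNReal.ofReal_ofNat, ← ENNReal.ofReal_pow (by norm_num)]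
      exact (ENNReal.ofReal_lt_ofReal_iff (by positivity)).mpr
        (lt_mul_of_one_lt_right (by positivity) hprod))
  have hmem := (Module.Basis.mem_span_iff_repr_mem ℤ (Pi.basisFun ℝ ι) x).mp hxL
  choose z hz using hmem
  have hxz : x = fun i => (z i : ℝ) := by ext i; simpa using (hz i).symm
  refine ⟨z, ?_, ?_⟩
  · rintro rfl
    apply hx0
    ext i
    simp [hxz]
  · intro i
    have := hxs i (mem_univ i)
    rw [abs_lt, ← hxz]
    simpa using this

/-- A unimodular lattice without short vectors has, for every coordinate `j`, a vector which is
small in all other coordinates, and bounded linearly independent vectors. -/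
lemma exists_independent_bounded {ι : Type*} [Fintype ι] [DecidableEq ι] {c : ℝ} (hc : 0 < c)
    (j₀ : ι) : ∃ R : ℝ, 0 < R ∧ ∀ g : Matrix ι ι ℝ, g.det = 1 →
      (∀ z : ι → ℤ, z ≠ 0 → c ≤ ‖g.mulVec (fun i => (z i : ℝ))‖) →
      ∃ z : ι → ι → ℤ, (∀ i, ‖g.mulVec (fun k => (z i k : ℝ))‖ ≤ R) ∧
        LinearIndependent ℝ (fun i => g.mulVec (fun k => (z i k : ℝ))) ∧
        c ≤ g.mulVec (fun k => (z j₀ k : ℝ)) j₀ := by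
  set D : ℝ := (Fintype.card ι : ℝ) with hD
  have hD1 : 1 ≤ D := by
    rw [hD]; exact_mod_cast Fintype.card_pos_iff.mpr ⟨j₀⟩
  set c' : ℝ := c / (2 * D) with hc'
  have hc'0 : 0 < c' := by positivity
  have hc'c : c' < c := by
    rw [hc', div_lt_iff₀ (by positivity)]; nlinarith
  set R : ℝ := 2 / c' ^ (Fintype.card ι - 1) + c with hR
  have hRpos : 0 < R := by positivity
  have hcR : c ≤ R := by rw [hR]; have : 0 < 2 / c' ^ (Fintype.card ι - 1) := by positivity
                         linarith
  refine ⟨R, hRpos, fun g hg hshort => ?_⟩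
  set v : (ι → ℤ) → (ι → ℝ) := fun z => g.mulVec (fun k => (z k : ℝ)) with hv
  have hbox : ∀ j : ι, ∃ z : ι → ℤ, z ≠ 0 ∧ ‖v z‖ ≤ R ∧ ∀ i, i ≠ j → |v z i| < c' := by
    intro j
    obtain ⟨z, hz0, hz⟩ := exists_int_vec_in_box g hg (Function.update (fun _ => c') j R)
      (fun i => by
        by_cases h : i = j
        · subst h; simpa using hRpos
        · simpa [h] using hc'0)
      (by
        rw [Finset.prod_update_of_mem (Finset.mem_univ j), Finset.prod_const,
          Finset.card_sdiff_of_subset (Finset.subset_univ _)]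
        simp only [Finset.card_univ, Finset.card_singleton]
        rw [hR, add_mul, div_mul_cancel₀ _ (by positivity)]
        have : 0 < c * c' ^ (Fintype.card ι - 1) := by positivity
        linarith)
    refine ⟨z, hz0, (pi_norm_le_iff_of_nonneg hRpos.le).mpr fun i => ?_, fun i hi => ?_⟩
    · have := hz i
      by_cases h : i = j
      · subst h; simpa using this.le
      · rw [Function.update_of_ne h] at this
        exact (this.trans (hc'c.trans_le hcR)).le
    · have := hz i
      rwa [Function.update_of_ne hi] at this
  -- the vector that is long in direction `j₀`
  obtain ⟨s, hsR, hsj⟩ : ∃ s : ι → ℤ, ‖v s‖ ≤ R ∧ c ≤ v s j₀ := by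
    obtain ⟨z, hz0, hzR, hz⟩ := hbox j₀
    have h1 : c ≤ |v z j₀| := by
      by_contra! hlt
      have : ‖v z‖ < c := (pi_norm_lt_iff hc).mpr fun i => by
        by_cases h : i = j₀
        · subst h; exact hlt
        · exact (hz i h).trans hc'c
      exact absurd (hshort z hz0) (not_le.mpr this)
    rcases le_abs.mp h1 with h | h
    · exact ⟨z, hzR, h⟩
    · have hneg : v (-z) = - v z := by
        simp only [hv]
        rw [← Matrix.mulVec_neg]
        congr 1
        ext i; simp
      exact ⟨-z, by rw [hneg, norm_neg]; exact hzR, by rw [hneg]; exact h⟩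
  set S : Set (ι → ℤ) := {z | ‖v z‖ ≤ R} with hS
  have hspan : Submodule.span ℝ (v '' S) = ⊤ := by
    by_contra hne
    obtain ⟨f, hf0, hf⟩ := Submodule.exists_le_ker_of_lt_top _ (lt_top_iff_ne_top.mpr hne)
    set l : ι → ℝ := fun i => f (Pi.single i 1) with hl
    have hfl : ∀ x : ι → ℝ, f x = ∑ i, x i * l i := by
      intro x
      conv_lhs => rw [← Finset.univ_sum_single x]
      rw [map_sum]
      refine Finset.sum_congr rfl fun i _ => ?_
      have : (Pi.single i (x i) : ι → ℝ) = x i • Pi.single i 1 := by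
        rw [← Pi.single_smul]; simp
      rw [this, map_smul, smul_eq_mul]
    obtain ⟨j, -, hj⟩ := Finset.exists_max_image Finset.univ (fun i => |l i|)
      ⟨j₀, Finset.mem_univ _⟩
    have hlj : 0 < |l j| := by
      by_contra! h
      apply hf0
      ext x
      rw [LinearMap.zero_comp, LinearMap.zero_apply, LinearMap.comp_apply, hfl]
      refine Finset.sum_eq_zero fun i _ => ?_
      have : l i = 0 := abs_nonpos_iff.mp ((hj i (Finset.mem_univ i)).trans h)
      simp [this]
    obtain ⟨z, hz0, hzR, hz⟩ := hbox j
    have hfz : f (v z) = 0 := hf (Submodule.subset_span ⟨z, hzR, rfl⟩)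
    rw [hfl, ← Finset.add_sum_erase _ _ (Finset.mem_univ j)] at hfz
    have h1 : |v z j * l j| ≤ (D * c') * |l j| := by
      have : v z j * l j = - ∑ i ∈ Finset.univ.erase j, v z i * l i := by linarith
      rw [this, abs_neg]
      calc |∑ i ∈ Finset.univ.erase j, v z i * l i|
          ≤ ∑ i ∈ Finset.univ.erase j, |v z i * l i| := Finset.abs_sum_le_sum_abs _ _
        _ ≤ ∑ i ∈ Finset.univ.erase j, c' * |l j| := Finset.sum_le_sum fun i hi => by
            rw [abs_mul]
            exact mul_le_mul (hz i (Finset.ne_of_mem_erase hi)).le (hj i (Finset.mem_univ i))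
              (abs_nonneg _) hc'0.le
        _ ≤ ∑ _i : ι, c' * |l j| := Finset.sum_le_sum_of_subset_of_nonneg (Finset.subset_univ _)
            fun _ _ _ => by positivity
        _ = (D * c') * |l j| := by simp [hD, mul_assoc]
    rw [abs_mul] at h1
    have h2 : |v z j| ≤ D * c' := le_of_mul_le_mul_right h1 hlj
    have h3 : D * c' < c := by
      rw [hc', mul_div_assoc', div_lt_iff₀ (by positivity)]; nlinarith
    have : ‖v z‖ < c := (pi_norm_lt_iff hc).mpr fun i => by
      by_cases h : i = j
      · subst h; exact h2.trans_lt h3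
      · exact (hz i h).trans hc'c
    exact absurd (hshort z hz0) (not_le.mpr this)
  have hvs0 : v s ≠ 0 := fun h => by
    rw [h] at hsj; simp only [Pi.zero_apply] at hsj; linarith
  obtain ⟨b, hbS, hsb, hSb, hbi⟩ := exists_linearIndepOn_extension (K := ℝ) (v := v) (s := {s})
    (t := S) ((linearIndepOn_singleton_iff ℝ).mpr hvs0) (by simpa [hS] using hsR)
  have htop : ⊤ ≤ Submodule.span ℝ (Set.range fun x : b => v x) := by
    rw [← hspan]
    refine Submodule.span_le.mpr (hSb.trans_eq ?_)
    rw [image_eq_range]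
  let bas := Module.Basis.mk hbi htop
  let e : ι ≃ b := (Pi.basisFun ℝ ι).indexEquiv bas
  let e' : ι ≃ b := (Equiv.swap j₀ (e.symm ⟨s, hsb rfl⟩)).trans e
  refine ⟨fun i => (e' i : ι → ℤ), fun i => hbS (e' i).2, ?_, ?_⟩
  · exact hbi.comp e' e'.injective
  · have : (e' j₀ : ι → ℤ) = s := by simp [e']
    simpa only [this] using hsj

/-- A unimodular lattice without short vectors contains, in each primitive residue class, a
primitive vector of bounded length whose `j₀`-th coordinate is at least one. -/
lemma exists_primitive_bounded {ι : Type*} [Fintype ι] [DecidableEq ι] (N : ℕ) (hN : 0 < N)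
    {c : ℝ} (hc : 0 < c) (j₀ j₁ : ι) (hj : j₀ ≠ j₁) :
    ∃ C : ℝ, 0 < C ∧ ∀ a : ι → ℤ, IsPrimitiveVec a → ∀ g : Matrix ι ι ℝ, g.det = 1 →
      (∀ z : ι → ℤ, z ≠ 0 → c ≤ ‖g.mulVec (fun i => (z i : ℝ))‖) →
      ∃ u : ι → ℤ, IsPrimitiveVec u ∧ (∀ i, u i ≡ a i [ZMOD N]) ∧
        ‖g.mulVec (fun i => (u i : ℝ))‖ ≤ C ∧ 1 ≤ g.mulVec (fun i => (u i : ℝ)) j₀ := by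
  obtain ⟨R, hR, hind⟩ := exists_independent_bounded hc j₀
  set D : ℝ := (Fintype.card ι : ℝ) with hD
  have hD1 : 1 ≤ D := by
    rw [hD]; exact_mod_cast Fintype.card_pos_iff.mpr ⟨j₀⟩
  set J₀ : ℝ := (Fintype.card ι).factorial * R ^ Fintype.card ι with hJ₀
  set W₀ : ℝ := N * J₀ ^ 2 with hW₀
  have hW₀0 : 0 ≤ W₀ := by positivity
  set T : ℤ := ⌈(J₀ + D * (W₀ * R)) / c⌉ with hT
  have hJ₀0 : 0 ≤ J₀ := by positivity
  have hT0 : 0 ≤ T := Int.ceil_nonneg (by positivity)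
  have hT0' : (0 : ℝ) ≤ T := by exact_mod_cast hT0
  have hTle : J₀ + D * (W₀ * R) ≤ T * c := by
    have := Int.le_ceil ((J₀ + D * (W₀ * R)) / c)
    rwa [div_le_iff₀ hc] at this
  refine ⟨D * ((T + W₀ + W₀ ^ 2) * R) + 1, by positivity, fun a ha g hg hshort => ?_⟩
  obtain ⟨z, hzR, hzind, hzc⟩ := hind g hg hshort
  set B : Matrix ι ι ℤ := Matrix.of fun k i => z i k with hB
  have hgB : ∀ (e : ι → ℤ), g.mulVec (fun k => (B.mulVec e k : ℝ)) =
      ∑ i, (e i : ℝ) • g.mulVec (fun k => (z i k : ℝ)) := by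
    intro e
    have : (fun k => (B.mulVec e k : ℝ)) = ∑ i, (e i : ℝ) • (fun k => (z i k : ℝ)) := by
      ext k
      simp [Matrix.mulVec, dotProduct, hB, mul_comm]
    rw [this, Matrix.mulVec_sum]
    simp only [Matrix.mulVec_smul]
  set G : Matrix ι ι ℝ := g * B.map (Int.cast : ℤ → ℝ) with hG
  have hGcol : ∀ k i, G k i = g.mulVec (fun k => (z i k : ℝ)) k := by
    intro k i
    simp [hG, Matrix.mul_apply, Matrix.mulVec, dotProduct, hB]
  have hdetG : G.det = (B.det : ℝ) := by
    rw [hG, det_mul, hg, one_mul]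
    exact (Int.cast_det B).symm
  have hG0 : G.det ≠ 0 := by
    have h1 : LinearIndependent ℝ G.col := by
      have h2 : G.col = fun i => g.mulVec (fun k => (z i k : ℝ)) := by
        ext i k
        exact hGcol k i
      rw [h2]
      exact hzind
    exact ((Matrix.isUnit_iff_isUnit_det G).mp
      (Matrix.linearIndependent_cols_iff_isUnit.mp h1)).ne_zero
  have hB0 : B.det ≠ 0 := fun h => hG0 (by rw [hdetG, h, Int.cast_zero])
  set J : ℤ := |B.det| with hJ
  have hJpos : 0 < J := abs_pos.mpr hB0
  have hJ1 : (1 : ℝ) ≤ J := by exact_mod_cast hJpos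
  have hJle : (J : ℝ) ≤ J₀ := by
    have h1 := Matrix.det_le (A := G) (abv := AbsoluteValue.abs) (x := R) fun k i => by
      rw [hGcol]
      exact (norm_le_pi_norm _ k).trans (hzR i)
    rw [hJ, Int.cast_abs, ← hdetG]
    simpa [hJ₀] using h1
  obtain ⟨u, e, hu, hua, hJu, he, heT, heT'⟩ := exists_primitive_of_sublattice B
    (B.det.sign • B.adjugate) J hJpos
    (fun v => by
      rw [Matrix.smul_mulVec, Matrix.mulVec_smul, Matrix.mulVec_mulVec, Matrix.mul_adjugate,
        Matrix.smul_mulVec, Matrix.one_mulVec, smul_smul, Int.sign_mul_self_eq_abs])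
    (fun v => by
      rw [Matrix.smul_mulVec, Matrix.mulVec_mulVec, Matrix.adjugate_mul,
        Matrix.smul_mulVec, Matrix.one_mulVec, smul_smul, Int.sign_mul_self_eq_abs])
    N hN a ha j₀ j₁ hj T
  have hWle : (N : ℝ) * (J : ℝ) ^ 2 ≤ W₀ := by
    rw [hW₀]; gcongr
  have hgu : (J : ℝ) • g.mulVec (fun k => (u k : ℝ)) =
      ∑ i, (e i : ℝ) • g.mulVec (fun k => (z i k : ℝ)) := by
    rw [← hgB, ← hJu, ← Matrix.mulVec_smul]
    congr 1
    ext k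
    simp
  have he1 : ∀ i, i ≠ j₀ → (0 : ℝ) ≤ e i ∧ (e i : ℝ) ≤ W₀ := fun i hi => by
    obtain ⟨h1, h2⟩ := he i hi
    refine ⟨by exact_mod_cast h1, le_trans ?_ hWle⟩
    exact_mod_cast h2
  have he2 : (T : ℝ) ≤ e j₀ := by exact_mod_cast heT
  have he3 : (e j₀ : ℝ) ≤ T + W₀ + W₀ ^ 2 := by
    have : (e j₀ : ℝ) ≤ T + N * (J : ℝ) ^ 2 + (N * (J : ℝ) ^ 2) ^ 2 := by exact_mod_cast heT'
    refine this.trans ?_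
    gcongr
  have heabs : ∀ i, |(e i : ℝ)| ≤ T + W₀ + W₀ ^ 2 := fun i => by
    by_cases h : i = j₀
    · subst h; rw [abs_of_nonneg (hT0'.trans he2)]; exact he3
    · rw [abs_of_nonneg (he1 i h).1]
      have := (he1 i h).2
      have : 0 ≤ W₀ ^ 2 := by positivity
      linarith
  refine ⟨u, hu, hua, ?_, ?_⟩
  · have h1 : ‖g.mulVec (fun k => (u k : ℝ))‖ ≤ ‖(J : ℝ) • g.mulVec (fun k => (u k : ℝ))‖ := by
      rw [norm_smul, Real.norm_of_nonneg (by linarith)]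
      exact le_mul_of_one_le_left (norm_nonneg _) hJ1
    refine h1.trans ?_
    rw [hgu]
    calc _ ≤ ∑ i, ‖(e i : ℝ) • g.mulVec (fun k => (z i k : ℝ))‖ := norm_sum_le _ _
      _ ≤ ∑ _i : ι, (T + W₀ + W₀ ^ 2) * R := Finset.sum_le_sum fun i _ => by
          rw [norm_smul]
          exact mul_le_mul (heabs i) (hzR i) (norm_nonneg _) (by positivity)
      _ = D * ((T + W₀ + W₀ ^ 2) * R) := by simp [hD]
      _ ≤ _ := by linarith
  · have h1 := congrFun hgu j₀
    simp only [Pi.smul_apply, smul_eq_mul, Finset.sum_apply] at h1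
    rw [← Finset.add_sum_erase _ _ (Finset.mem_univ j₀)] at h1
    have h2 : |∑ i ∈ Finset.univ.erase j₀, (e i : ℝ) * g.mulVec (fun k => (z i k : ℝ)) j₀| ≤
        D * (W₀ * R) := by
      calc _ ≤ ∑ i ∈ Finset.univ.erase j₀, |(e i : ℝ) * g.mulVec (fun k => (z i k : ℝ)) j₀| :=
            Finset.abs_sum_le_sum_abs _ _
        _ ≤ ∑ i ∈ Finset.univ.erase j₀, W₀ * R := Finset.sum_le_sum fun i hi => by
            rw [abs_mul, abs_of_nonneg (he1 i (Finset.ne_of_mem_erase hi)).1]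
            exact mul_le_mul (he1 i (Finset.ne_of_mem_erase hi)).2
              ((norm_le_pi_norm _ j₀).trans (hzR i)) (abs_nonneg _) hW₀0
        _ ≤ ∑ _i : ι, W₀ * R := Finset.sum_le_sum_of_subset_of_nonneg (Finset.subset_univ _)
            fun _ _ _ => by positivity
        _ = D * (W₀ * R) := by simp [hD]
    have h3 : (T : ℝ) * c ≤ e j₀ * g.mulVec (fun k => (z j₀ k : ℝ)) j₀ :=
      mul_le_mul he2 hzc hc.le (hT0'.trans he2)
    have h4 := (abs_le.mp h2).1
    have h5 : (J : ℝ) * 1 ≤ J * g.mulVec (fun k => (u k : ℝ)) j₀ := by linarith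
    exact le_of_mul_le_mul_left h5 (by linarith)

/-- A quantitative second moment inequality for a finite family of sets contained in `W`. -/
lemma second_moment_inequality {α κ : Type*} [MeasurableSpace α] (μ : Measure α) (I : Finset κ)
    (B : κ → Set α) (hB : ∀ a, MeasurableSet (B a)) (hfin : ∀ a, μ (B a) ≠ ⊤)
    {W : Set α} (hW : MeasurableSet W) (hWfin : μ W ≠ ⊤) (hsub : ∀ a ∈ I, B a ⊆ W) (t : ℝ) :
    2 * t * ∑ a ∈ I, μ.real (B a) ≤
      ∑ a ∈ I, ∑ b ∈ I, μ.real (B a ∩ B b) + t ^ 2 * μ.real W := by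
  have hint : ∀ s : Set α, MeasurableSet s → μ s ≠ ⊤ →
      Integrable (s.indicator (fun _ => (1 : ℝ))) μ := fun s hs hf =>
    (integrable_indicator_iff hs).mpr (integrableOn_const hf)
  have hval : ∀ s : Set α, MeasurableSet s → ∫ x, s.indicator (fun _ => (1 : ℝ)) x ∂μ = μ.real s :=
    fun s hs => by rw [integral_indicator_const _ hs]; simp
  have hBB : ∀ a b, Integrable ((B a ∩ B b).indicator (fun _ => (1 : ℝ))) μ := fun a b =>
    hint _ ((hB a).inter (hB b)) (measure_ne_top_of_subset inter_subset_left (hfin a))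
  have hL : 2 * t * ∑ a ∈ I, μ.real (B a) =
      ∫ x, 2 * t * ∑ a ∈ I, (B a).indicator (fun _ => (1 : ℝ)) x ∂μ := by
    rw [integral_const_mul, integral_finsetSum _ fun a _ => hint _ (hB a) (hfin a)]
    simp only [hval _ (hB _)]
  have hsum : Integrable (fun x => ∑ a ∈ I, ∑ b ∈ I,
      (B a ∩ B b).indicator (fun _ => (1 : ℝ)) x) μ :=
    integrable_finsetSum _ fun a _ => integrable_finsetSum _ fun b _ => hBB a b
  have hR : ∑ a ∈ I, ∑ b ∈ I, μ.real (B a ∩ B b) + t ^ 2 * μ.real W =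
      ∫ x, (∑ a ∈ I, ∑ b ∈ I, (B a ∩ B b).indicator (fun _ => (1 : ℝ)) x) +
        t ^ 2 * W.indicator (fun _ => (1 : ℝ)) x ∂μ := by
    rw [integral_add hsum ((hint W hW hWfin).const_mul _), integral_const_mul, hval W hW,
      integral_finsetSum _ fun a _ => integrable_finsetSum _ fun b _ => hBB a b]
    congr 1
    refine Finset.sum_congr rfl fun a _ => ?_
    rw [integral_finsetSum _ fun b _ => hBB a b]
    exact Finset.sum_congr rfl fun b _ => (hval _ ((hB a).inter (hB b))).symm
  rw [hL, hR]
  refine integral_mono ((integrable_finsetSum _ fun a _ => hint _ (hB a) (hfin a)).const_mul _)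
    (hsum.add ((hint W hW hWfin).const_mul _)) fun x => ?_
  have hsq : ∑ a ∈ I, ∑ b ∈ I, (B a ∩ B b).indicator (fun _ => (1 : ℝ)) x =
      (∑ a ∈ I, (B a).indicator (fun _ => (1 : ℝ)) x) ^ 2 := by
    rw [pow_two, Finset.sum_mul_sum]
    refine Finset.sum_congr rfl fun a _ => Finset.sum_congr rfl fun b _ => ?_
    by_cases h1 : x ∈ B a <;> by_cases h2 : x ∈ B b <;> simp [h1, h2]
  simp only [hsq]
  by_cases hx : x ∈ W
  · simp only [indicator_of_mem hx]
    nlinarith [sq_nonneg ((∑ a ∈ I, (B a).indicator (fun _ => (1 : ℝ)) x) - t)]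
  · have : ∑ a ∈ I, (B a).indicator (fun _ => (1 : ℝ)) x = 0 :=
      Finset.sum_eq_zero fun a ha => indicator_of_notMem (fun h => hx (hsub a ha h)) _
    rw [this, indicator_of_notMem hx]
    simp

lemma volumeReal_closedBall_pi {m : ℕ} (z : Fin m → ℝ) {R : ℝ} (hR : 0 ≤ R) :
    volume.real (Metric.closedBall z R) = (2 * R) ^ m := by
  rw [measureReal_def, Real.volume_pi_closedBall _ hR, Fintype.card_fin,
    ENNReal.toReal_ofReal (by positivity)]

/-- Packing bound for a separated finite set in a ball of the maximum norm. -/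
lemma card_mul_pow_le_of_separated {m : ℕ} (Y : Finset (Fin m → ℝ)) {δ R : ℝ} (hδ : 0 < δ)
    (hR : 0 ≤ R) (z : Fin m → ℝ) (hY : ∀ y ∈ Y, dist y z ≤ R)
    (hsep : ∀ y ∈ Y, ∀ y' ∈ Y, y ≠ y' → δ ≤ dist y y') :
    (Y.card : ℝ) * δ ^ m ≤ (2 * R + δ) ^ m := by
  have hdisj : (Y : Set (Fin m → ℝ)).PairwiseDisjoint (fun y => Metric.ball y (δ / 2)) := by
    intro y hy y' hy' hne
    refine Metric.ball_disjoint_ball ?_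
    have := hsep y hy y' hy' hne
    linarith
  have hvol : ∀ y : Fin m → ℝ, volume.real (Metric.ball y (δ / 2)) = δ ^ m := fun y => by
    rw [measureReal_def, Real.volume_pi_ball _ (by linarith), Fintype.card_fin,
      ENNReal.toReal_ofReal (by positivity)]
    congr 1; ring
  have h1 : volume.real (⋃ y ∈ Y, Metric.ball y (δ / 2)) = Y.card * δ ^ m := by
    rw [measureReal_biUnion_finset hdisj (fun y _ => measurableSet_ball)
      (fun y _ => measure_ball_lt_top.ne)]
    simp [hvol]
  have h2 : volume.real (Metric.closedBall z (R + δ / 2)) = (2 * R + δ) ^ m := by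
    rw [volumeReal_closedBall_pi _ (by linarith)]; congr 1; ring
  rw [← h1, ← h2]
  refine measureReal_mono ?_ measure_closedBall_lt_top.ne
  refine iUnion₂_subset fun y hy => ?_
  refine Metric.ball_subset_closedBall.trans (Metric.closedBall_subset_closedBall' ?_)
  linarith [hY y hy]

/-- A bounded set contains a finite separated net. -/
lemma exists_separated_net {m : ℕ} {G : Set (Fin m → ℝ)} {z : Fin m → ℝ} {R σ : ℝ} (hσ : 0 < σ)
    (hR : 0 ≤ R) (hG : G ⊆ Metric.closedBall z R) :
    ∃ Z : Finset (Fin m → ℝ), ↑Z ⊆ G ∧ (∀ y ∈ Z, ∀ y' ∈ Z, y ≠ y' → σ ≤ dist y y') ∧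
      ∀ x ∈ G, ∃ y ∈ Z, dist x y ≤ σ := by
  classical
  by_contra! hcon
  have key : ∀ k : ℕ, ∃ Z : Finset (Fin m → ℝ), ↑Z ⊆ G ∧
      (∀ y ∈ Z, ∀ y' ∈ Z, y ≠ y' → σ ≤ dist y y') ∧ Z.card = k := by
    intro k
    induction k with
    | zero => exact ⟨∅, by simp⟩
    | succ k ih =>
      obtain ⟨Z, hZG, hZ, hk⟩ := ih
      obtain ⟨x, hx, hfar⟩ := hcon Z hZG hZ
      have hxZ : x ∉ Z := fun h => by
        have := hfar x h
        rw [dist_self] at this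
        linarith
      refine ⟨insert x Z, ?_, ?_, by rw [Finset.card_insert_of_notMem hxZ, hk]⟩
      · rw [Finset.coe_insert]; exact insert_subset hx hZG
      · intro y hy y' hy' hne
        rcases Finset.mem_insert.mp hy with rfl | h1 <;>
          rcases Finset.mem_insert.mp hy' with rfl | h2
        · exact absurd rfl hne
        · exact (hfar _ h2).le
        · rw [dist_comm]; exact (hfar _ h1).le
        · exact hZ y h1 y' h2 hne
  obtain ⟨k, hk⟩ := exists_nat_gt ((2 * R + σ) ^ m / σ ^ m)
  obtain ⟨Z, hZG, hZ, hcard⟩ := key k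
  have := card_mul_pow_le_of_separated Z hσ hR z (fun y hy => hG (hZG hy)) hZ
  rw [hcard, ← le_div_iff₀ (by positivity)] at this
  linarith

/-- Extraction of a large separated set of resonant points from a covering property. -/
lemma exists_separated_resonant {m : ℕ} {X G : Set (Fin m → ℝ)} {z : Fin m → ℝ} {R δ C : ℝ}
    (hδ : 0 < δ) (hC : 0 ≤ C) (hsmall : (C + 1) * δ ≤ R / 2)
    (hG : G ⊆ Metric.closedBall z (R / 2)) (hGX : ∀ x ∈ G, ∃ y ∈ X, dist x y ≤ C * δ)
    (hvol : R ^ m / 2 ≤ volume.real G) :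
    ∃ Y : Finset (Fin m → ℝ), ↑Y ⊆ X ∧ (∀ y ∈ Y, dist y z ≤ R - δ) ∧
      (∀ y ∈ Y, ∀ y' ∈ Y, y ≠ y' → δ ≤ dist y y') ∧
      R ^ m / 2 ≤ Y.card * (2 * (2 * C + 1) * δ) ^ m := by
  classical
  have hR : 0 ≤ R / 2 := by
    have : 0 < (C + 1) * δ := by positivity
    linarith
  obtain ⟨Z, hZG, hZ, hcov⟩ := exists_separated_net (σ := (2 * C + 1) * δ) (by positivity) hR hG
  have hch : ∀ x : Fin m → ℝ, ∃ y, x ∈ G → y ∈ X ∧ dist x y ≤ C * δ := fun x => by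
    by_cases hx : x ∈ G
    · obtain ⟨y, hy⟩ := hGX x hx
      exact ⟨y, fun _ => hy⟩
    · exact ⟨x, fun h => absurd h hx⟩
  choose f hf using hch
  have hsepf : ∀ a ∈ Z, ∀ b ∈ Z, a ≠ b → δ ≤ dist (f a) (f b) := by
    intro a ha b hb hne
    have h1 := (hf a (hZG ha)).2
    have h2 := (hf b (hZG hb)).2
    have h3 := hZ a ha b hb hne
    have h4 : dist a b ≤ dist a (f a) + dist (f a) (f b) + dist b (f b) := by
      have := dist_triangle4 a (f a) (f b) b
      rwa [dist_comm (f b) b] at this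
    linarith
  have hinj : Set.InjOn f Z := by
    intro a ha b hb hab
    by_contra hne
    have := hsepf a ha b hb hne
    rw [hab, dist_self] at this
    linarith
  refine ⟨Z.image f, ?_, ?_, ?_, ?_⟩
  · intro y hy
    obtain ⟨x, hx, rfl⟩ := Finset.mem_image.mp hy
    exact (hf x (hZG hx)).1
  · intro y hy
    obtain ⟨x, hx, rfl⟩ := Finset.mem_image.mp hy
    have h1 := (hf x (hZG hx)).2
    have h2 : dist x z ≤ R / 2 := hG (hZG hx)
    have h3 := dist_triangle_left (f x) z x
    linarith
  · intro y hy y' hy' hne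
    obtain ⟨a, ha, rfl⟩ := Finset.mem_image.mp hy
    obtain ⟨b, hb, rfl⟩ := Finset.mem_image.mp hy'
    exact hsepf a ha b hb fun h => hne (by rw [h])
  · rw [Finset.card_image_of_injOn hinj]
    refine hvol.trans ?_
    have hsub : G ⊆ ⋃ y ∈ Z, Metric.closedBall y ((2 * C + 1) * δ) := fun x hx => by
      obtain ⟨y, hy, hxy⟩ := hcov x hx
      exact mem_iUnion₂.mpr ⟨y, hy, hxy⟩
    refine (measureReal_mono hsub ?_).trans ((measureReal_biUnion_finset_le _ _).trans ?_)
    · exact (lt_of_le_of_lt (measure_biUnion_finset_le _ _)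
        (ENNReal.sum_lt_top.mpr fun y _ => measure_closedBall_lt_top)).ne
    · simp only [volumeReal_closedBall_pi _ (show 0 ≤ (2 * C + 1) * δ by positivity),
        Finset.sum_const, nsmul_eq_mul]
      rw [mul_assoc 2]

/-- Overlap of one ball with the balls around a separated set. -/
lemma sum_volume_inter_le {m : ℕ} (Y : Finset (Fin m → ℝ)) {δ r r' : ℝ} (hδ : 0 < δ)
    (hr : 0 ≤ r) (hr' : 0 ≤ r') (hrδ : r' ≤ δ) (y : Fin m → ℝ)
    (hsep : ∀ y ∈ Y, ∀ y' ∈ Y, y ≠ y' → δ ≤ dist y y') :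
    ∑ y' ∈ Y, volume.real (Metric.closedBall y r ∩ Metric.closedBall y' r') ≤
      12 ^ m * ((r / δ) ^ m + 1) * r' ^ m := by
  classical
  set Y' := Y.filter (fun y' => dist y' y ≤ r + r') with hY'
  have h1 : ∑ y' ∈ Y, volume.real (Metric.closedBall y r ∩ Metric.closedBall y' r') ≤
      ∑ y' ∈ Y', (2 * r') ^ m := by
    rw [hY', Finset.sum_filter]
    refine Finset.sum_le_sum fun y' _ => ?_
    split_ifs with h
    · rw [← volumeReal_closedBall_pi y' hr']
      exact measureReal_mono inter_subset_right measure_closedBall_lt_top.ne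
    · have : Metric.closedBall y r ∩ Metric.closedBall y' r' = ∅ := by
        refine (Metric.closedBall_disjoint_closedBall ?_).inter_eq
        rw [dist_comm]
        linarith
      rw [this]; simp
  refine h1.trans ?_
  have h2 := card_mul_pow_le_of_separated Y' hδ (add_nonneg hr hr') y
    (fun y' hy' => (Finset.mem_filter.mp hy').2)
    (fun a ha b hb => hsep a (Finset.mem_of_mem_filter a ha) b (Finset.mem_of_mem_filter b hb))
  have h3 : (Y'.card : ℝ) ≤ 6 ^ m * ((r / δ) ^ m + 1) := by
    rw [← le_div_iff₀ (by positivity), ← div_pow] at h2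
    refine h2.trans ?_
    have h4 : (2 * (r + r') + δ) / δ ≤ 6 * max (r / δ) 1 := by
      rw [div_le_iff₀ hδ]
      have e1 : r / δ * δ = r := by field_simp
      have e2 := le_max_left (r / δ) 1
      have e3 := le_max_right (r / δ) 1
      nlinarith
    refine (pow_le_pow_left₀ (by positivity) h4 m).trans ?_
    rw [mul_pow]
    gcongr
    rcases max_choice (r / δ) 1 with h | h <;> rw [h]
    · linarith
    · have : 0 ≤ (r / δ) ^ m := by positivity
      simpa using this
  rw [Finset.sum_const, nsmul_eq_mul]
  calc (Y'.card : ℝ) * (2 * r') ^ m ≤ (6 ^ m * ((r / δ) ^ m + 1)) * (2 * r') ^ m := by gcongr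
    _ = 12 ^ m * ((r / δ) ^ m + 1) * r' ^ m := by
      rw [mul_pow, show (12 : ℝ) = 6 * 2 by norm_num, mul_pow]; ring

lemma sum_range_half_pow_dist_le (k n : ℕ) :
    ∑ l ∈ Finset.range n, (1 / 2 : ℝ) ^ ((l - k) + (k - l)) ≤ 3 := by
  have h1 : ∀ k : ℕ, ∑ l ∈ Finset.range k, (1 / 2 : ℝ) ^ (k - l) ≤ 1 := by
    intro k
    induction k with
    | zero => simp
    | succ k ih =>
      rw [Finset.sum_range_succ]
      have : ∑ l ∈ Finset.range k, (1 / 2 : ℝ) ^ (k + 1 - l) =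
          (1 / 2) * ∑ l ∈ Finset.range k, (1 / 2 : ℝ) ^ (k - l) := by
        rw [Finset.mul_sum]
        refine Finset.sum_congr rfl fun l hl => ?_
        rw [Nat.sub_add_comm (Finset.mem_range.mp hl).le, pow_succ']
      rw [this]
      norm_num at ih ⊢
      linarith
  have h2 : ∑ l ∈ Finset.range n, (1 / 2 : ℝ) ^ ((l - k) + (k - l)) ≤
      ∑ l ∈ Finset.range (k + n), (1 / 2 : ℝ) ^ ((l - k) + (k - l)) :=
    Finset.sum_le_sum_of_subset_of_nonneg (Finset.range_mono (by omega)) fun _ _ _ => by positivity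
  refine h2.trans ?_
  rw [Finset.sum_range_add]
  have h3 : ∑ x ∈ Finset.range n, (1 / 2 : ℝ) ^ ((k + x - k) + (k - (k + x))) ≤ 2 := by
    have : ∀ x, (k + x - k) + (k - (k + x)) = x := fun x => by omega
    simp only [this]
    exact sum_geometric_two_le n
  have h4 : ∑ x ∈ Finset.range k, (1 / 2 : ℝ) ^ ((x - k) + (k - x)) ≤ 1 := by
    refine le_trans (le_of_eq ?_) (h1 k)
    refine Finset.sum_congr rfl fun l hl => ?_
    rw [Nat.sub_eq_zero_of_le (Finset.mem_range.mp hl).le, zero_add]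
  linarith

/-- Quasi-independence on average for two separated families of balls. -/
lemma sum_sum_volume_inter_le {m : ℕ} (hm : 0 < m) (Y Y' : Finset (Fin m → ℝ))
    {δ δ' r r' R q : ℝ} {z : Fin m → ℝ} (hδ : 0 < δ) (hδ' : 0 < δ') (hδR : δ ≤ R)
    (hr : 0 ≤ r) (hr' : 0 ≤ r') (hrδ' : r' ≤ δ') (hq : 0 ≤ q) (hq1 : q ≤ 1) (hδq : δ' ≤ q * δ)
    (hY : ∀ y ∈ Y, dist y z ≤ R - δ)
    (hsep : ∀ y ∈ Y, ∀ y' ∈ Y, y ≠ y' → δ ≤ dist y y')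
    (hsep' : ∀ y ∈ Y', ∀ y' ∈ Y', y ≠ y' → δ' ≤ dist y y') :
    ∑ y ∈ Y, ∑ y' ∈ Y', volume.real (Metric.closedBall y r ∩ Metric.closedBall y' r') ≤
      (24 * R) ^ m * ((r / δ) ^ m * (r' / δ') ^ m + (r' / δ') ^ m * q) := by
  have hcard : (Y.card : ℝ) * δ ^ m ≤ (2 * R) ^ m :=
    (card_mul_pow_le_of_separated Y hδ (by linarith) z hY hsep).trans
      (pow_le_pow_left₀ (by linarith) (by linarith) m)
  have h1 : ∑ y ∈ Y, ∑ y' ∈ Y', volume.real (Metric.closedBall y r ∩ Metric.closedBall y' r') ≤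
      Y.card * (12 ^ m * ((r / δ') ^ m + 1) * r' ^ m) := by
    rw [← nsmul_eq_mul]
    exact Finset.sum_le_card_nsmul _ _ _
      (fun y _ => sum_volume_inter_le Y' hδ' hr hr' hrδ' y hsep')
  refine h1.trans ?_
  have e1 : (Y.card : ℝ) * (12 ^ m * ((r / δ') ^ m + 1) * r' ^ m) =
      12 ^ m * ((Y.card * δ ^ m) * ((r / δ) ^ m * (r' / δ') ^ m) +
        (Y.card * δ' ^ m) * (r' / δ') ^ m) := by
    simp only [div_pow]
    field_simp
  have hδm : δ' ^ m ≤ δ ^ m * q := by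
    calc δ' ^ m ≤ (q * δ) ^ m := pow_le_pow_left₀ hδ'.le hδq m
      _ = q ^ m * δ ^ m := mul_pow _ _ _
      _ ≤ q * δ ^ m := by
        gcongr
        exact pow_le_of_le_one hq hq1 hm.ne'
      _ = _ := mul_comm _ _
  have e2 : (Y.card : ℝ) * δ' ^ m ≤ (2 * R) ^ m * q := by
    calc (Y.card : ℝ) * δ' ^ m ≤ Y.card * (δ ^ m * q) := by gcongr
      _ = (Y.card * δ ^ m) * q := by ring
      _ ≤ _ := by gcongr
  have e3 : (24 * R) ^ m = 12 ^ m * (2 * R) ^ m := by rw [← mul_pow]; ring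
  rw [e1, e3, mul_assoc ((12 : ℝ) ^ m)]
  have hs : 0 ≤ (r / δ) ^ m := by positivity
  have hs' : 0 ≤ (r' / δ') ^ m := by positivity
  refine mul_le_mul_of_nonneg_left ?_ (by positivity)
  calc _ ≤ (2 * R) ^ m * ((r / δ) ^ m * (r' / δ') ^ m) + ((2 * R) ^ m * q) * (r' / δ') ^ m := by
        exact add_le_add (mul_le_mul_of_nonneg_right hcard (mul_nonneg hs hs'))
          (mul_le_mul_of_nonneg_right e2 hs')
    _ = _ := by ring

lemma sum_Ico_sum_Ico_le {J : ℕ → ℕ → ℝ} {s : ℕ → ℝ} {A : ℝ} {a n : ℕ} (hA : 0 ≤ A)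
    (hs : ∀ k, 0 ≤ s k) (hsymm : ∀ k l, J k l = J l k)
    (hJ : ∀ k l, a ≤ k → k ≤ l → J k l ≤ A * (s k * s l + s l * (1 / 2) ^ (l - k)))
    (hS : 2 ≤ ∑ k ∈ Finset.Ico a n, s k) :
    ∑ k ∈ Finset.Ico a n, ∑ l ∈ Finset.Ico a n, J k l ≤
      A * (4 * (∑ k ∈ Finset.Ico a n, s k) ^ 2) := by
  set S := ∑ k ∈ Finset.Ico a n, s k with hSdef
  have hpair : ∀ k ∈ Finset.Ico a n, ∀ l ∈ Finset.Ico a n,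
      J k l ≤ A * (s k * s l + (s k + s l) * (1 / 2) ^ ((l - k) + (k - l))) := by
    intro k hk l hl
    have hk' := (Finset.mem_Ico.mp hk).1
    have hl' := (Finset.mem_Ico.mp hl).1
    have hsk := hs k
    have hsl := hs l
    rcases le_total k l with hkl | hkl
    · refine (hJ k l hk' hkl).trans ?_
      rw [Nat.sub_eq_zero_of_le hkl, add_zero]
      gcongr
      linarith
    · rw [hsymm]
      refine (hJ l k hl' hkl).trans ?_
      rw [Nat.sub_eq_zero_of_le hkl, zero_add, mul_comm (s l)]
      gcongr
      linarith
  have hw : ∀ k, ∑ l ∈ Finset.Ico a n, (1 / 2 : ℝ) ^ ((l - k) + (k - l)) ≤ 3 := fun k =>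
    (Finset.sum_le_sum_of_subset_of_nonneg
      (fun l hl => Finset.mem_range.mpr (Finset.mem_Ico.mp hl).2)
      (fun _ _ _ => by positivity)).trans (sum_range_half_pow_dist_le k n)
  have hsum1 : ∑ k ∈ Finset.Ico a n, ∑ l ∈ Finset.Ico a n,
      s k * (1 / 2 : ℝ) ^ ((l - k) + (k - l)) ≤ 3 * S := by
    rw [hSdef, Finset.mul_sum]
    refine Finset.sum_le_sum fun k _ => ?_
    rw [← Finset.mul_sum, mul_comm]
    exact mul_le_mul_of_nonneg_right (hw k) (hs k)
  have hsum2 : ∑ k ∈ Finset.Ico a n, ∑ l ∈ Finset.Ico a n,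
      s l * (1 / 2 : ℝ) ^ ((l - k) + (k - l)) ≤ 3 * S := by
    rw [Finset.sum_comm]
    refine le_trans (le_of_eq ?_) hsum1
    refine Finset.sum_congr rfl fun k _ => Finset.sum_congr rfl fun l _ => ?_
    rw [add_comm (l - k)]
  calc _ ≤ ∑ k ∈ Finset.Ico a n, ∑ l ∈ Finset.Ico a n,
        A * (s k * s l + (s k + s l) * (1 / 2) ^ ((l - k) + (k - l))) :=
        Finset.sum_le_sum fun k hk => Finset.sum_le_sum fun l hl => hpair k hk l hl
    _ = A * (S * S + (∑ k ∈ Finset.Ico a n, ∑ l ∈ Finset.Ico a n,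
          s k * (1 / 2 : ℝ) ^ ((l - k) + (k - l)) + ∑ k ∈ Finset.Ico a n,
          ∑ l ∈ Finset.Ico a n, s l * (1 / 2 : ℝ) ^ ((l - k) + (k - l)))) := by
        rw [hSdef, Finset.sum_mul_sum, ← Finset.sum_add_distrib, ← Finset.sum_add_distrib,
          Finset.mul_sum]
        refine Finset.sum_congr rfl fun k _ => ?_
        rw [← Finset.sum_add_distrib, ← Finset.sum_add_distrib, Finset.mul_sum]
        refine Finset.sum_congr rfl fun l _ => ?_
        ring
    _ ≤ A * (4 * S ^ 2) := by
        refine mul_le_mul_of_nonneg_left ?_ hA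
        nlinarith

/-- A positive proportion of every ball is covered by the tail of the family of balls. -/
lemma exists_local_proportion {m : ℕ} (hm : 0 < m) (X : ℕ → Set (Fin m → ℝ))
    (hX : ∀ k, (X k).Countable) (δ r : ℕ → ℝ) {C : ℝ} (hC : 0 ≤ C) (hδ : ∀ k, 0 < δ k)
    (hδle : ∀ k l, k ≤ l → δ l ≤ (1 / 2) ^ (l - k) * δ k)
    (hr : ∀ k, 0 ≤ r k) (hrδ : ∀ k, r k ≤ δ k)
    (hcov : ∀ (z : Fin m → ℝ) (R : ℝ), 0 < R → ∃ k₀, ∀ k ≥ k₀,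
      volume.real (Metric.closedBall z R) / 2 ≤
        volume.real {x ∈ Metric.closedBall z R | ∃ y ∈ X k, dist x y ≤ C * δ k})
    (hdiv : ¬ Summable (fun k => (r k / δ k) ^ m)) :
    ∃ η : ℝ, 0 < η ∧ ∀ (z : Fin m → ℝ) (R : ℝ), 0 < R → ∀ K : ℕ,
      η * R ^ m ≤ volume.real (Metric.closedBall z R ∩
        ⋃ k ≥ K, ⋃ y ∈ X k, Metric.closedBall y (r k)) := by
  classical
  set τ : ℝ := 8 * 24 ^ m * (2 * C + 1) ^ m with hτ
  have hτ0 : 0 < τ := by positivity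
  refine ⟨4 * 24 ^ m / τ ^ 2, by positivity, fun z R hR K => ?_⟩
  set W : Set (Fin m → ℝ) := Metric.closedBall z R ∩
    ⋃ k ≥ K, ⋃ y ∈ X k, Metric.closedBall y (r k) with hWdef
  have hWm : MeasurableSet W := by
    refine Metric.isClosed_closedBall.measurableSet.inter ?_
    refine MeasurableSet.iUnion fun k => MeasurableSet.iUnion fun _ => ?_
    exact MeasurableSet.biUnion (hX k) fun y _ => Metric.isClosed_closedBall.measurableSet
  have hWfin : volume W ≠ ⊤ :=
    ((measure_mono inter_subset_left).trans_lt
      (isCompact_closedBall z R).measure_lt_top).ne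
  obtain ⟨k₀, hk₀⟩ := hcov z (R / 2) (by linarith)
  have hδlim : Filter.Tendsto δ Filter.atTop (nhds 0) := by
    have h1 : Filter.Tendsto (fun k : ℕ => (1 / 2 : ℝ) ^ k * δ 0) Filter.atTop (nhds 0) := by
      simpa using (tendsto_pow_atTop_nhds_zero_of_lt_one (r := (1 / 2 : ℝ)) (by norm_num)
        (by norm_num)).mul_const (δ 0)
    exact squeeze_zero (fun k => (hδ k).le) (fun k => by simpa using hδle 0 k (Nat.zero_le _)) h1
  have hsmall : ∀ᶠ k in Filter.atTop, (C + 1) * δ k < R / 2 := by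
    have h1 : Filter.Tendsto (fun k => (C + 1) * δ k) Filter.atTop (nhds 0) := by
      simpa using hδlim.const_mul (C + 1)
    exact h1.eventually_lt_const (by linarith)
  obtain ⟨k₂, hk₂⟩ := Filter.eventually_atTop.mp hsmall
  set k₁ := max K (max k₀ k₂) with hk₁
  have hY : ∀ k, ∃ Y : Finset (Fin m → ℝ), k₁ ≤ k → (↑Y ⊆ X k ∧ (∀ y ∈ Y, dist y z ≤ R - δ k) ∧
      (∀ y ∈ Y, ∀ y' ∈ Y, y ≠ y' → δ k ≤ dist y y') ∧
      R ^ m / 2 ≤ Y.card * (2 * (2 * C + 1) * δ k) ^ m) := by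
    intro k
    by_cases hk : k₁ ≤ k
    · have hkk : k₀ ≤ k ∧ k₂ ≤ k ∧ K ≤ k := by omega
      have h1 := hk₀ k hkk.1
      rw [volumeReal_closedBall_pi z (by linarith), show 2 * (R / 2) = R by ring] at h1
      obtain ⟨Y, h2⟩ := exists_separated_resonant (X := X k) (hδ k) hC (hk₂ k hkk.2.1).le
        (fun x hx => hx.1) (fun x hx => hx.2) h1
      exact ⟨Y, fun _ => h2⟩
    · exact ⟨∅, fun h => absurd h hk⟩
  choose Y hY using hY
  set s : ℕ → ℝ := fun k => (r k / δ k) ^ m with hs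
  have hs0 : ∀ k, 0 ≤ s k := fun k => pow_nonneg (div_nonneg (hr k) (hδ k).le) m
  obtain ⟨n, hn⟩ : ∃ n, 2 ≤ ∑ k ∈ Finset.Ico k₁ n, s k := by
    have h1 := (not_summable_iff_tendsto_nat_atTop_of_nonneg hs0).mp hdiv
    obtain ⟨n, hn1, hn2⟩ := ((h1.eventually_ge_atTop (2 + ∑ k ∈ Finset.range k₁, s k)).and
      (Filter.eventually_ge_atTop k₁)).exists
    refine ⟨n, ?_⟩
    rw [Finset.sum_Ico_eq_sub _ hn2]
    linarith
  set S := ∑ k ∈ Finset.Ico k₁ n, s k with hS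
  set I : Finset (Σ _ : ℕ, Fin m → ℝ) := (Finset.Ico k₁ n).sigma Y with hI
  set B : (Σ _ : ℕ, Fin m → ℝ) → Set (Fin m → ℝ) := fun a => Metric.closedBall a.2 (r a.1) with hB
  have hδR : ∀ k, k₁ ≤ k → δ k ≤ R := by
    intro k hk
    have h1 := hk₂ k (by omega)
    nlinarith [hδ k]
  have key := second_moment_inequality volume I B
    (fun a => Metric.isClosed_closedBall.measurableSet)
    (fun a => (isCompact_closedBall _ _).measure_lt_top.ne) hWm hWfin ?_ (τ * S)
  swap
  · rintro ⟨k, y⟩ ha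
    simp only [hI, Finset.mem_sigma, Finset.mem_Ico] at ha
    have hk := hY k ha.1.1
    intro x hx
    have hx' : dist x y ≤ r k := hx
    refine ⟨?_, ?_⟩
    · have h1 := hk.2.1 y ha.2
      have h2 := dist_triangle x y z
      have h3 := hrδ k
      exact Metric.mem_closedBall.mpr (by linarith)
    · simp only [mem_iUnion]
      exact ⟨k, by omega, y, hk.1 ha.2, hx⟩
  have hfirst : R ^ m / 2 / (2 * C + 1) ^ m * S ≤ ∑ a ∈ I, volume.real (B a) := by
    rw [hI, Finset.sum_sigma, hS, Finset.mul_sum]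
    refine Finset.sum_le_sum fun k hk => ?_
    have hk' := (hY k (Finset.mem_Ico.mp hk).1).2.2.2
    have h1 : ∑ y ∈ Y k, volume.real (B ⟨k, y⟩) = (Y k).card * (2 * r k) ^ m := by
      rw [Finset.sum_congr rfl (fun y _ => volumeReal_closedBall_pi y (hr k)),
        Finset.sum_const, nsmul_eq_mul]
    rw [h1]
    have h2 : ((Y k).card : ℝ) * (2 * r k) ^ m =
        ((Y k).card * (2 * (2 * C + 1) * δ k) ^ m) / (2 * C + 1) ^ m * s k := by
      have := (hδ k).ne'
      simp only [hs, div_pow, mul_pow]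
      field_simp
    rw [h2]
    have := hs0 k
    gcongr
  have hsecond : ∑ a ∈ I, ∑ b ∈ I, volume.real (B a ∩ B b) ≤ (24 * R) ^ m * (4 * S ^ 2) := by
    have hone : ∀ k l, k₁ ≤ k → k ≤ l →
        ∑ y ∈ Y k, ∑ y' ∈ Y l, volume.real (B ⟨k, y⟩ ∩ B ⟨l, y'⟩) ≤
          (24 * R) ^ m * (s k * s l + s l * (1 / 2) ^ (l - k)) := by
      intro k l hk hkl
      have hq : (0 : ℝ) ≤ (1 / 2) ^ (l - k) := by positivity
      have hq1 : (1 / 2 : ℝ) ^ (l - k) ≤ 1 := pow_le_one₀ (by norm_num) (by norm_num)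
      obtain ⟨-, hY1, hY2, -⟩ := hY k hk
      obtain ⟨-, -, hY3, -⟩ := hY l (hk.trans hkl)
      have h1 := sum_sum_volume_inter_le hm (Y k) (Y l) (hδ k) (hδ l)
        (hδR k hk) (hr k) (hr l) (hrδ l) hq hq1 (hδle k l hkl) hY1 hY2 hY3
      exact h1
    have hexp : ∑ a ∈ I, ∑ b ∈ I, volume.real (B a ∩ B b) =
        ∑ k ∈ Finset.Ico k₁ n, ∑ l ∈ Finset.Ico k₁ n,
          ∑ y ∈ Y k, ∑ y' ∈ Y l, volume.real (B ⟨k, y⟩ ∩ B ⟨l, y'⟩) := by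
      rw [hI, Finset.sum_sigma]
      refine Finset.sum_congr rfl fun k _ => ?_
      simp_rw [Finset.sum_sigma]
      rw [Finset.sum_comm]
    clear key hfirst hcov
    rw [hexp]
    refine sum_Ico_sum_Ico_le (by positivity) hs0 (fun k l => ?_) hone hn
    rw [Finset.sum_comm]
    simp_rw [inter_comm (B ⟨k, _⟩)]
  have hSpos : 0 < S := by linarith
  have h3 : 2 * (τ * S) * (R ^ m / 2 / (2 * C + 1) ^ m * S) ≤
      (24 * R) ^ m * (4 * S ^ 2) + (τ * S) ^ 2 * volume.real W :=
    (mul_le_mul_of_nonneg_left hfirst (by positivity)).trans (key.trans (by gcongr))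
  have h4 : 2 * (τ * S) * (R ^ m / 2 / (2 * C + 1) ^ m * S) =
      8 * 24 ^ m * R ^ m * S ^ 2 := by
    rw [hτ]
    field_simp
  rw [h4, mul_pow] at h3
  have h5 : (4 * 24 ^ m * R ^ m) * S ^ 2 ≤ (τ ^ 2 * volume.real W) * S ^ 2 := by nlinarith
  have h6 := le_of_mul_le_mul_right h5 (by positivity)
  rw [div_mul_eq_mul_div, div_le_iff₀ (by positivity)]
  linarith

/-- Divergence part of a local-ubiquity Borel–Cantelli lemma in the maximum norm. -/
theorem ae_frequently_dist_le_of_ubiquity {m : ℕ} (hm : 0 < m) (X : ℕ → Set (Fin m → ℝ))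
    (hX : ∀ k, (X k).Countable) (δ r : ℕ → ℝ) {C : ℝ} (hC : 0 ≤ C) (hδ : ∀ k, 0 < δ k)
    (hδle : ∀ k l, k ≤ l → δ l ≤ (1 / 2) ^ (l - k) * δ k)
    (hr : ∀ k, 0 ≤ r k) (hrδ : ∀ k, r k ≤ δ k)
    (hcov : ∀ (z : Fin m → ℝ) (R : ℝ), 0 < R → ∃ k₀, ∀ k ≥ k₀,
      volume.real (Metric.closedBall z R) / 2 ≤
        volume.real {x ∈ Metric.closedBall z R | ∃ y ∈ X k, dist x y ≤ C * δ k})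
    (hdiv : ¬ Summable (fun k => (r k / δ k) ^ m)) :
    ∀ᵐ x : Fin m → ℝ, ∀ K : ℕ, ∃ k ≥ K, ∃ y ∈ X k, dist x y ≤ r k := by
  obtain ⟨η, hη, hloc⟩ := exists_local_proportion hm X hX δ r hC hδ hδle hr hrδ hcov hdiv
  rw [ae_all_iff]
  intro K
  set V : Set (Fin m → ℝ) := ⋃ k ≥ K, ⋃ y ∈ X k, Metric.closedBall y (r k) with hV
  have hVm : MeasurableSet V := by
    refine MeasurableSet.iUnion fun k => MeasurableSet.iUnion fun _ => ?_
    exact MeasurableSet.biUnion (hX k) fun y _ => Metric.isClosed_closedBall.measurableSet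
  have hnull : volume Vᶜ = 0 := by
    by_contra hne
    have hdens := Besicovitch.ae_tendsto_measure_inter_div (volume : Measure (Fin m → ℝ)) Vᶜ
    have : (ae (volume.restrict Vᶜ)).NeBot := by
      rw [ae_neBot]
      simpa [Measure.restrict_eq_zero] using hne
    obtain ⟨x, hx⟩ := hdens.exists
    have hbound : ∀ᶠ R in nhdsWithin (0 : ℝ) (Ioi 0),
        volume (Vᶜ ∩ Metric.closedBall x R) / volume (Metric.closedBall x R) ≤
          ENNReal.ofReal (1 - η / 2 ^ m) := by
      filter_upwards [self_mem_nhdsWithin] with R hR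
      have hR : 0 < R := hR
      have hfin : volume (Metric.closedBall x R) ≠ ⊤ := (isCompact_closedBall x R).measure_lt_top.ne
      have h1 := hloc x R hR K
      have h2 : volume.real (Metric.closedBall x R ∩ V) + volume.real (Metric.closedBall x R \ V) =
          volume.real (Metric.closedBall x R) := measureReal_inter_add_sdiff hVm
      rw [volumeReal_closedBall_pi x hR.le] at h2
      rw [inter_comm, ← sdiff_eq]
      rw [Real.volume_pi_closedBall _ hR.le, Fintype.card_fin,
        ← ENNReal.ofReal_toReal (measure_ne_top_of_subset sdiff_subset hfin),
        ← ENNReal.ofReal_div_of_pos (by positivity)]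
      refine ENNReal.ofReal_le_ofReal ?_
      rw [← measureReal_def, div_le_iff₀ (by positivity), mul_pow]
      have h3 : (1 - η / 2 ^ m) * (2 ^ m * R ^ m) = 2 ^ m * R ^ m - η * R ^ m := by
        field_simp
      rw [h3, ← mul_pow]
      linarith
    have hle := le_of_tendsto hx hbound
    rw [ENNReal.one_le_ofReal] at hle
    have : 0 < η / 2 ^ m := by positivity
    linarith
  have hVae : ∀ᵐ x : Fin m → ℝ, x ∈ V := by
    rw [ae_iff]
    exact hnull
  filter_upwards [hVae] with x hx
  simp only [hV, mem_iUnion] at hx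
  obtain ⟨k, hk, y, hy, hxy⟩ := hx
  exact ⟨k, hk, y, hy, hxy⟩

lemma volume_real_near_int_le {s ε r : ℝ} (hs : s ≠ 0) (hε2 : ε ≤ 1 / 2) (hr : 0 ≤ r)
    (a b : ℝ) :
    volume {t ∈ Metric.closedBall a r | ∃ p : ℤ, |p + b + s * t| ≤ ε} ≤
      ENNReal.ofReal ((2 * r * |s| + 2) * (2 * ε / |s|)) := by
  have hs' : 0 < |s| := abs_pos.mpr hs
  set lo : ℤ := ⌈-(b + s * a) - (ε + |s| * r)⌉ with hlo
  set hi : ℤ := ⌊-(b + s * a) + (ε + |s| * r)⌋ with hhi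
  have hsub : {t ∈ Metric.closedBall a r | ∃ p : ℤ, |p + b + s * t| ≤ ε} ⊆
      ⋃ p ∈ Finset.Icc lo hi, Metric.closedBall (-(p + b) / s) (ε / |s|) := by
    rintro t ⟨ht, p, hp⟩
    rw [Metric.mem_closedBall, Real.dist_eq] at ht
    have h1 : |s * (t - a)| ≤ |s| * r := by
      rw [abs_mul]
      exact mul_le_mul_of_nonneg_left ht hs'.le
    rw [abs_le] at h1 hp
    simp only [mem_iUnion, Finset.mem_Icc]
    refine ⟨p, ⟨Int.ceil_le.mpr (by linarith), Int.le_floor.mpr (by linarith)⟩, ?_⟩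
    rw [Metric.mem_closedBall, Real.dist_eq, le_div_iff₀ hs', ← abs_mul, abs_le]
    have h2 : (t - -(p + b) / s) * s = p + b + s * t := by
      field_simp
      ring
    rw [h2]
    exact hp
  have hcard : ((Finset.Icc lo hi).card : ℝ) ≤ 2 * r * |s| + 2 := by
    rw [Int.card_Icc]
    have h1 := Int.le_ceil (-(b + s * a) - (ε + |s| * r))
    have h2 := Int.floor_le (-(b + s * a) + (ε + |s| * r))
    have h3 : ((hi + 1 - lo : ℤ) : ℝ) ≤ 2 * r * |s| + 2 := by
      push_cast
      linarith
    rcases le_total (hi + 1 - lo) 0 with h | h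
    · rw [Int.toNat_of_nonpos h]
      simp only [Nat.cast_zero]
      positivity
    · have h4 : (((hi + 1 - lo).toNat : ℤ) : ℝ) = ((hi + 1 - lo : ℤ) : ℝ) := by
        rw [Int.toNat_of_nonneg h]
      rw [Int.cast_natCast] at h4
      linarith
  calc _ ≤ ∑ p ∈ Finset.Icc lo hi, volume (Metric.closedBall (-((p : ℝ) + b) / s) (ε / |s|)) :=
        (measure_mono hsub).trans (measure_biUnion_finset_le _ _)
    _ = (Finset.Icc lo hi).card * ENNReal.ofReal (2 * ε / |s|) := by
        simp only [Real.volume_closedBall, Finset.sum_const, nsmul_eq_mul]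
        rw [mul_div_assoc]
    _ ≤ ENNReal.ofReal (2 * r * |s| + 2) * ENNReal.ofReal (2 * ε / |s|) := by
        gcongr
        rw [← ENNReal.ofReal_natCast]
        exact ENNReal.ofReal_le_ofReal hcard
    _ = _ := (ENNReal.ofReal_mul (by positivity)).symm

lemma volume_pi_near_int_le {m : ℕ} {s ε r : ℝ} (hs : s ≠ 0) (hε : 0 < ε) (hε2 : ε ≤ 1 / 2)
    (hr : 0 ≤ r) (z b : Fin m → ℝ) :
    volume {x ∈ Metric.closedBall z r | ∃ p : Fin m → ℤ, ∀ i, |p i + b i + s * x i| ≤ ε} ≤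
      ENNReal.ofReal (((2 * r * |s| + 2) * (2 * ε / |s|)) ^ m) := by
  have hsub : {x ∈ Metric.closedBall z r | ∃ p : Fin m → ℤ, ∀ i, |p i + b i + s * x i| ≤ ε} ⊆
      Set.pi univ (fun i => {t ∈ Metric.closedBall (z i) r | ∃ p : ℤ, |p + b i + s * t| ≤ ε}) := by
    rintro x ⟨hx, p, hp⟩ i -
    refine ⟨?_, p i, hp i⟩
    rw [closedBall_pi z hr] at hx
    exact hx i (mem_univ i)
  refine (measure_mono hsub).trans ?_
  rw [volume_pi_pi]
  refine (Finset.prod_le_prod' fun i _ =>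
    volume_real_near_int_le hs hε2 hr (z i) (b i)).trans ?_
  rw [Finset.prod_const, Finset.card_univ, Fintype.card_fin, ENNReal.ofReal_pow (by positivity)]

/-- The vector `p + A q` for `u = (p, q)`. -/
def blockForm {m n : ℕ} (A : Matrix (Fin m) (Fin n) ℝ) (u : Fin m ⊕ Fin n → ℤ) : Fin m → ℝ :=
  fun i => u (Sum.inl i) + A.mulVec (fun j => (u (Sum.inr j) : ℝ)) i

/-- Integer vectors whose `j₀`-th lower coordinate vanishes eventually do not give good
approximations for `A`. -/
def IsGenericAt {m n : ℕ} (A : Matrix (Fin m) (Fin n) ℝ) (j₀ : Fin n) : Prop :=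
  ∃ k₀ : ℕ, ∀ k ≥ k₀, ∀ u : Fin m ⊕ Fin n → ℤ, (∃ j, u (Sum.inr j) ≠ 0) → u (Sum.inr j₀) = 0 →
    (∀ j, |(u (Sum.inr j) : ℝ)| ≤ 2 ^ (m * k)) → (1 / 2 : ℝ) ^ (n * k) < ‖blockForm A u‖

lemma sum_piFinset_apply_eq {n : ℕ} (S : Finset ℤ) (f : ℤ → ℝ) (j₀ : Fin n) :
    ∑ q ∈ Fintype.piFinset (fun _ : Fin n => S), f (q j₀) =
      (∑ s ∈ S, f s) * (S.card : ℝ) ^ (n - 1) := by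
  classical
  have h := Finset.prod_univ_sum (fun _ : Fin n => S)
    (fun i s => if i = j₀ then f s else 1)
  have h1 : ∀ q : Fin n → ℤ, ∏ i, (if i = j₀ then f (q i) else 1) = f (q j₀) := by
    intro q
    rw [Finset.prod_ite_eq' Finset.univ j₀ (fun i => f (q i)), if_pos (Finset.mem_univ _)]
  simp_rw [h1] at h
  rw [← h, ← Finset.mul_prod_erase Finset.univ _ (Finset.mem_univ j₀)]
  simp only [if_true]
  congr 1
  rw [Finset.prod_congr rfl (g := fun _ => (S.card : ℝ)), Finset.prod_const,
    Finset.card_erase_of_mem (Finset.mem_univ _), Finset.card_univ, Fintype.card_fin]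
  intro i hi
  simp [Finset.ne_of_mem_erase hi]

lemma exists_volume_short_vector_le {m n : ℕ} (hm : 0 < m) (hn : 0 < n)
    (A : Matrix (Fin m) (Fin n) ℝ) (j₀ : Fin n) (hA : IsGenericAt A j₀) (z : Fin m → ℝ) {r : ℝ}
    (hr : 0 < r) : ∃ k₀, ∀ k ≥ k₀,
      volume.real {x ∈ Metric.closedBall z r | ∃ u : Fin m ⊕ Fin n → ℤ, u ≠ 0 ∧
        (∀ i, |blockForm A u i + u (Sum.inr j₀) * x i| < 1 / 12 * (1 / 2) ^ (n * k)) ∧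
        ∀ j, |(u (Sum.inr j) : ℝ)| < 1 / 12 * 2 ^ (m * k)} ≤ (2 * r) ^ m / 2 := by
  obtain ⟨k₁, hk₁⟩ := hA
  obtain ⟨s₀, hs₀⟩ := exists_nat_ge (1 / r)
  set E : ℝ := (2 * s₀ + 1) * (2 * r + 2) ^ m with hE
  have hTlim : Filter.Tendsto (fun k : ℕ => (2 : ℝ) ^ (m * k)) Filter.atTop Filter.atTop := by
    simp_rw [pow_mul]
    exact tendsto_pow_atTop_atTop_of_one_lt (one_lt_pow₀ (by norm_num) hm.ne')
  obtain ⟨k₂, hk₂⟩ := Filter.eventually_atTop.mp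
    ((hTlim.eventually_ge_atTop 12).and (hTlim.eventually_ge_atTop (E / ((2 * r) ^ m / 4))))
  refine ⟨max k₁ k₂, fun k hk => ?_⟩
  obtain ⟨hT12, hTE⟩ := hk₂ k (by omega)
  set T : ℝ := 2 ^ (m * k) with hT
  set ε : ℝ := (1 / 2) ^ (n * k) with hε
  have hT0 : 0 < T := by positivity
  have hε0 : 0 < ε := by positivity
  have hε1 : ε ≤ 1 := pow_le_one₀ (by norm_num) (by norm_num)
  have hTε : ε ^ m * T ^ n = 1 := by
    rw [hT, hε, ← pow_mul, ← pow_mul, show n * k * m = m * k * n by ring, ← mul_pow]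
    norm_num
  set L : ℕ := ⌊1 / 12 * T⌋₊ with hL
  have hLT : (L : ℝ) ≤ 1 / 12 * T := Nat.floor_le (by positivity)
  set S : Finset ℤ := Finset.Icc (-(L : ℤ)) L with hS
  have hScard : (S.card : ℝ) ≤ 1 / 4 * T := by
    have h1 : S.card = 2 * L + 1 := by
      rw [hS, Int.card_Icc]
      omega
    rw [h1]
    push_cast
    linarith
  set f : ℤ → ℝ := fun s => if s = 0 then 0 else
    ((2 * r * |(s : ℝ)| + 2) * (2 * (1 / 12 * ε) / |(s : ℝ)|)) ^ m with hf
  set V : (Fin n → ℤ) → Set (Fin m → ℝ) := fun q => if q j₀ = 0 then ∅ else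
    {x ∈ Metric.closedBall z r | ∃ p : Fin m → ℤ, ∀ i,
      |p i + A.mulVec (fun j => (q j : ℝ)) i + (q j₀ : ℝ) * x i| ≤ 1 / 12 * ε} with hV
  have hVf : ∀ q, volume (V q) ≤ ENNReal.ofReal (f (q j₀)) := by
    intro q
    by_cases hq : q j₀ = 0
    · simp [hV, hf, hq]
    · simp only [hV, hf, hq, if_false]
      exact volume_pi_near_int_le (Int.cast_ne_zero.mpr hq) (by positivity) (by linarith) hr.le
        z (fun i => A.mulVec (fun j => (q j : ℝ)) i)
  have hf0 : ∀ s, 0 ≤ f s := by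
    intro s
    simp only [hf]
    split_ifs <;> positivity
  have hsub : {x ∈ Metric.closedBall z r | ∃ u : Fin m ⊕ Fin n → ℤ, u ≠ 0 ∧
        (∀ i, |blockForm A u i + u (Sum.inr j₀) * x i| < 1 / 12 * ε) ∧
        ∀ j, |(u (Sum.inr j) : ℝ)| < 1 / 12 * T} ⊆
      ⋃ q ∈ Fintype.piFinset (fun _ : Fin n => S), V q := by
    rintro x ⟨hx, u, hu0, hu1, hu2⟩
    simp only [mem_iUnion]
    refine ⟨fun j => u (Sum.inr j), ?_, ?_⟩
    · rw [Fintype.mem_piFinset]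
      intro j
      have h1 : (u (Sum.inr j)).natAbs ≤ L := by
        refine Nat.le_floor ?_
        rw [Nat.cast_natAbs, Int.cast_abs]
        exact (hu2 j).le
      rw [hS, Finset.mem_Icc]
      omega
    · by_cases hq : u (Sum.inr j₀) = 0
      · exfalso
        have h1 : ‖blockForm A u‖ < 1 / 12 * ε := by
          rw [pi_norm_lt_iff (by positivity)]
          intro i
          simpa [hq] using hu1 i
        by_cases hex : ∃ j, u (Sum.inr j) ≠ 0
        · have h2 := hk₁ k (by omega) u hex hq (fun j => (hu2 j).le.trans (by linarith))
          linarith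
        · push Not at hex
          refine hu0 (funext fun i => ?_)
          rcases i with i | j
          · have h2 := hu1 i
            simp only [blockForm, hex, Int.cast_zero, zero_mul, add_zero] at h2
            have h3 : A.mulVec (fun _ : Fin n => (0 : ℝ)) i = 0 := by
              simp [Matrix.mulVec, dotProduct]
            rw [h3, add_zero, ← Int.cast_abs] at h2
            have h4 : (|u (Sum.inl i)| : ℤ) < 1 := by
              have : ((|u (Sum.inl i)| : ℤ) : ℝ) < 1 := by linarith
              exact_mod_cast this
            simpa using Int.abs_lt_one_iff.mp h4
          · exact hex j
      · simp only [hV, hq, if_false]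
        exact ⟨hx, fun i => u (Sum.inl i), fun i => (hu1 i).le⟩
  have hsumf : ∑ s ∈ S, f s ≤ (1 / 6 * ε) ^ m * (1 / 4 * T * (4 * r) ^ m + E) := by
    have hpt : ∀ s : ℤ, f s ≤ (1 / 6 * ε) ^ m * ((4 * r) ^ m +
        if s ∈ Finset.Icc (-(s₀ : ℤ)) s₀ then (2 * r + 2) ^ m else 0) := by
      intro s
      by_cases hs : s = 0
      · simp only [hf, hs, if_true]
        split_ifs <;> positivity
      have hs1 : (1 : ℝ) ≤ |(s : ℝ)| := by
        rw [← Int.cast_abs]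
        exact_mod_cast Int.one_le_abs hs
      have e1 : f s = (1 / 6 * ε) ^ m * (2 * r + 2 / |(s : ℝ)|) ^ m := by
        simp only [hf, hs, if_false]
        rw [← mul_pow]
        congr 1
        field_simp
        ring
      rw [e1]
      refine mul_le_mul_of_nonneg_left ?_ (by positivity)
      split_ifs with h
      · have h1 : 2 / |(s : ℝ)| ≤ 2 := by
          rw [div_le_iff₀ (by linarith)]
          linarith
        have h2 : (2 * r + 2 / |(s : ℝ)|) ^ m ≤ (2 * r + 2) ^ m := by gcongr
        have : 0 ≤ (4 * r) ^ m := by positivity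
        linarith
      · have h1 : (s₀ : ℝ) ≤ |(s : ℝ)| := by
          rw [← Int.cast_abs]
          have : (s₀ : ℤ) ≤ |s| := by
            rw [Finset.mem_Icc, ← abs_le] at h
            omega
          exact_mod_cast this
        have h2 : 2 / |(s : ℝ)| ≤ 2 * r := by
          rw [div_le_iff₀ (by linarith)]
          have h3 : 1 ≤ |(s : ℝ)| * r := by
            rw [div_le_iff₀ hr] at hs₀
            nlinarith
          linarith
        rw [add_zero]
        refine pow_le_pow_left₀ (by positivity) ?_ m
        linarith
    refine (Finset.sum_le_sum fun s _ => hpt s).trans ?_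
    rw [← Finset.mul_sum]
    refine mul_le_mul_of_nonneg_left ?_ (by positivity)
    rw [Finset.sum_add_distrib, Finset.sum_const, nsmul_eq_mul, ← Finset.sum_filter,
      Finset.sum_const, nsmul_eq_mul]
    refine add_le_add (mul_le_mul_of_nonneg_right hScard (by positivity)) ?_
    refine mul_le_mul_of_nonneg_right ?_ (by positivity)
    have h1 : (S.filter (fun s => s ∈ Finset.Icc (-(s₀ : ℤ)) s₀)).card ≤ 2 * s₀ + 1 := by
      refine (Finset.card_le_card (fun s hs => (Finset.mem_filter.mp hs).2)).trans ?_
      rw [Int.card_Icc]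
      omega
    exact_mod_cast h1
  have hmeas : volume {x ∈ Metric.closedBall z r | ∃ u : Fin m ⊕ Fin n → ℤ, u ≠ 0 ∧
        (∀ i, |blockForm A u i + u (Sum.inr j₀) * x i| < 1 / 12 * ε) ∧
        ∀ j, |(u (Sum.inr j) : ℝ)| < 1 / 12 * T} ≤ ENNReal.ofReal ((2 * r) ^ m / 2) := by
    refine (measure_mono hsub).trans ((measure_biUnion_finset_le _ _).trans ?_)
    refine (Finset.sum_le_sum fun q _ => hVf q).trans ?_
    rw [← ENNReal.ofReal_sum_of_nonneg (fun q _ => hf0 _)]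
    refine ENNReal.ofReal_le_ofReal ?_
    rw [sum_piFinset_apply_eq S f j₀]
    have hTn : T * T ^ (n - 1) = T ^ n := by
      rw [← pow_succ', Nat.sub_add_cancel hn]
    have hTn1 : ε ^ m * T ^ (n - 1) * T = 1 := by rw [mul_assoc, mul_comm _ T, hTn, hTε]
    have h4n : (1 / 4 : ℝ) ^ (n - 1) ≤ 1 := pow_le_one₀ (by norm_num) (by norm_num)
    have h6m : (1 / 6 : ℝ) ^ m ≤ 1 := pow_le_one₀ (by norm_num) (by norm_num)
    have h3m : (1 / 3 : ℝ) ^ m ≤ 1 := pow_le_one₀ (by norm_num) (by norm_num)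
    have hE0 : 0 ≤ E := by positivity
    have hr0 : 0 ≤ (2 * r) ^ m := by positivity
    have hET : E / T ≤ (2 * r) ^ m / 4 := by
      rw [div_le_iff₀ (by positivity)] at hTE
      rw [div_le_iff₀ hT0]
      linarith
    calc (∑ s ∈ S, f s) * (S.card : ℝ) ^ (n - 1)
        ≤ ((1 / 6 * ε) ^ m * (1 / 4 * T * (4 * r) ^ m + E)) * (1 / 4 * T) ^ (n - 1) :=
          mul_le_mul hsumf (pow_le_pow_left₀ (by positivity) hScard _) (by positivity)
            (by positivity)
      _ = (ε ^ m * T ^ (n - 1) * T) * (1 / 4) ^ (n - 1) * ((1 / 4) * ((1 / 6) ^ m * (4 * r) ^ m)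
            + (1 / 6) ^ m * (E / T)) := by
          rw [mul_pow, mul_pow (1 / 4 : ℝ) T]
          field_simp
      _ = (1 / 4) ^ (n - 1) * ((1 / 4) * ((1 / 3) ^ m * (2 * r) ^ m) + (1 / 6) ^ m * (E / T)) := by
          rw [hTn1, one_mul, ← mul_pow, ← mul_pow, show 1 / 6 * (4 * r) = 1 / 3 * (2 * r) by ring]
      _ ≤ 1 * ((1 / 4) * (1 * (2 * r) ^ m) + 1 * ((2 * r) ^ m / 4)) := by gcongr
      _ = (2 * r) ^ m / 2 := by ring
  rw [measureReal_def]
  exact ENNReal.toReal_le_of_le_ofReal (by positivity) hmeas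

/-- Near every point outside a set of small measure there is a rational point of controlled
height coming from a primitive vector in a prescribed congruence class. -/
lemma exists_primitive_near {m n N : ℕ} (hm : 0 < m) (hN : 0 < N) (j₀ : Fin n) :
    ∃ C : ℝ, 0 < C ∧ ∀ (A : Matrix (Fin m) (Fin n) ℝ) (a : Fin m ⊕ Fin n → ℤ), IsPrimitiveVec a →
      ∀ (k : ℕ) (x : Fin m → ℝ),
      (¬ ∃ u : Fin m ⊕ Fin n → ℤ, u ≠ 0 ∧
        (∀ i, |blockForm A u i + u (Sum.inr j₀) * x i| < 1 / 12 * (1 / 2) ^ (n * k)) ∧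
        ∀ j, |(u (Sum.inr j) : ℝ)| < 1 / 12 * 2 ^ (m * k)) →
      ∃ u : Fin m ⊕ Fin n → ℤ, IsPrimitiveVec u ∧ (∀ i, u i ≡ a i [ZMOD N]) ∧
        2 ^ (m * k) ≤ (u (Sum.inr j₀) : ℝ) ∧ (∀ j, |(u (Sum.inr j) : ℝ)| ≤ C * 2 ^ (m * k)) ∧
        ∀ i, |blockForm A u i + u (Sum.inr j₀) * x i| ≤ C * (1 / 2) ^ (n * k) := by
  obtain ⟨C, hC, hex⟩ := exists_primitive_bounded (ι := Fin m ⊕ Fin n) N hN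
    (c := 1 / 12) (by norm_num) (Sum.inr j₀) (Sum.inl ⟨0, hm⟩) (by simp)
  refine ⟨C, hC, fun A a ha k x hx => ?_⟩
  set T : ℝ := 2 ^ (m * k) with hT
  set ε : ℝ := (1 / 2) ^ (n * k) with hε
  have hT0 : 0 < T := by positivity
  have hε0 : 0 < ε := by positivity
  have hTε : ε ^ m * T ^ n = 1 := by
    rw [hT, hε, ← pow_mul, ← pow_mul, show n * k * m = m * k * n by ring, ← mul_pow]
    norm_num
  set B : Matrix (Fin m) (Fin n) ℝ := fun i j => A i j + if j = j₀ then x i else 0 with hB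
  set g : Matrix (Fin m ⊕ Fin n) (Fin m ⊕ Fin n) ℝ :=
    Matrix.fromBlocks (ε⁻¹ • 1) (ε⁻¹ • B) 0 (T⁻¹ • 1) with hg
  have hdet : g.det = 1 := by
    rw [hg, Matrix.det_fromBlocks_zero₂₁, Matrix.det_smul, Matrix.det_smul, Matrix.det_one,
      Matrix.det_one, Fintype.card_fin, Fintype.card_fin, mul_one, mul_one, inv_pow, inv_pow,
      ← mul_inv, hTε, inv_one]
  have hl : ∀ (z : Fin m ⊕ Fin n → ℤ) (i : Fin m), g.mulVec (fun i => (z i : ℝ)) (Sum.inl i) =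
      ε⁻¹ * (blockForm A z i + z (Sum.inr j₀) * x i) := by
    intro z i
    have h1 : B.mulVec (fun j => (z (Sum.inr j) : ℝ)) i =
        A.mulVec (fun j => (z (Sum.inr j) : ℝ)) i + z (Sum.inr j₀) * x i := by
      simp only [Matrix.mulVec, dotProduct, hB, add_mul, Finset.sum_add_distrib, ite_mul, zero_mul,
        Finset.sum_ite_eq', Finset.mem_univ, if_true]
      rw [mul_comm (x i)]
    rw [hg, Matrix.fromBlocks_mulVec, Sum.elim_inl, Pi.add_apply, Matrix.smul_mulVec,
      Matrix.smul_mulVec, Matrix.one_mulVec, Pi.smul_apply, Pi.smul_apply, smul_eq_mul,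
      smul_eq_mul, blockForm, add_assoc, ← h1, mul_add]
    rfl
  have hr : ∀ (z : Fin m ⊕ Fin n → ℤ) (j : Fin n), g.mulVec (fun i => (z i : ℝ)) (Sum.inr j) =
      T⁻¹ * z (Sum.inr j) := by
    intro z j
    rw [hg, Matrix.fromBlocks_mulVec, Sum.elim_inr, Pi.add_apply, Matrix.zero_mulVec,
      Matrix.smul_mulVec, Matrix.one_mulVec, Pi.smul_apply, smul_eq_mul, Pi.zero_apply, zero_add]
    rfl
  obtain ⟨u, hu1, hu2, hu3, hu4⟩ := hex a ha g hdet (by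
    intro z hz
    by_contra! hlt
    rw [pi_norm_lt_iff (by norm_num)] at hlt
    refine hx ⟨z, hz, fun i => ?_, fun j => ?_⟩
    · have h1 := hlt (Sum.inl i)
      rw [hl, Real.norm_eq_abs, abs_mul, abs_of_pos (by positivity), inv_mul_lt_iff₀ hε0] at h1
      linarith
    · have h1 := hlt (Sum.inr j)
      rw [hr, Real.norm_eq_abs, abs_mul, abs_of_pos (by positivity), inv_mul_lt_iff₀ hT0] at h1
      linarith)
  rw [pi_norm_le_iff_of_nonneg hC.le] at hu3
  refine ⟨u, hu1, hu2, ?_, fun j => ?_, fun i => ?_⟩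
  · rw [hr, le_inv_mul_iff₀ hT0] at hu4
    linarith
  · have h1 := hu3 (Sum.inr j)
    rw [hr, Real.norm_eq_abs, abs_mul, abs_of_pos (by positivity), inv_mul_le_iff₀ hT0] at h1
    linarith
  · have h1 := hu3 (Sum.inl i)
    rw [hl, Real.norm_eq_abs, abs_mul, abs_of_pos (by positivity), inv_mul_le_iff₀ hε0] at h1
    linarith

/-- Khintchine-type divergence theorem for approximation by primitive vectors in a congruence
class, along one column. -/
theorem ae_frequently_primitive_approx {m n N : ℕ} (hm : 0 < m) (hN : 0 < N) (j₀ : Fin n) :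
    ∃ C : ℝ, 0 < C ∧ ∀ (A : Matrix (Fin m) (Fin n) ℝ), IsGenericAt A j₀ →
      ∀ a : Fin m ⊕ Fin n → ℤ, IsPrimitiveVec a → ∀ ρ : ℕ → ℝ, (∀ k, 0 ≤ ρ k) →
      (∀ k, ρ k ≤ (1 / 2) ^ (n * k)) →
      ¬ Summable (fun k => (ρ k * 2 ^ (n * k)) ^ m) →
      ∀ᵐ x : Fin m → ℝ, ∀ K : ℕ, ∃ k ≥ K, ∃ u : Fin m ⊕ Fin n → ℤ, IsPrimitiveVec u ∧
        (∀ i, u i ≡ a i [ZMOD N]) ∧ 2 ^ (m * k) ≤ (u (Sum.inr j₀) : ℝ) ∧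
        (∀ j, |(u (Sum.inr j) : ℝ)| ≤ C * 2 ^ (m * k)) ∧
        ∀ i, |blockForm A u i + u (Sum.inr j₀) * x i| ≤ C * ρ k := by
  have hn : 0 < n := j₀.pos
  obtain ⟨C, hC, hnear⟩ := exists_primitive_near (n := n) hm hN j₀
  refine ⟨C, hC, fun A hA a ha ρ hρ0 hρ1 hdiv => ?_⟩
  set X : ℕ → Set (Fin m → ℝ) := fun k => {y | ∃ u : Fin m ⊕ Fin n → ℤ, IsPrimitiveVec u ∧
    (∀ i, u i ≡ a i [ZMOD N]) ∧ 2 ^ (m * k) ≤ (u (Sum.inr j₀) : ℝ) ∧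
    (∀ j, |(u (Sum.inr j) : ℝ)| ≤ C * 2 ^ (m * k)) ∧
    y = fun i => -(blockForm A u i / u (Sum.inr j₀))} with hX
  have hXc : ∀ k, (X k).Countable := by
    intro k
    refine (countable_range (fun u : Fin m ⊕ Fin n → ℤ =>
      (fun i => -(blockForm A u i / u (Sum.inr j₀)) : Fin m → ℝ))).mono ?_
    rintro y ⟨u, -, -, -, -, rfl⟩
    exact ⟨u, rfl⟩
  set δ : ℕ → ℝ := fun k => (1 / 2) ^ ((m + n) * k) with hδ
  have hT : ∀ k : ℕ, (0 : ℝ) < 2 ^ (m * k) := fun k => by positivity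
  have hδ' : ∀ k, δ k * 2 ^ (m * k) = (1 / 2) ^ (n * k) := by
    intro k
    simp only [hδ]
    rw [add_mul, pow_add, mul_right_comm, ← mul_pow]
    norm_num
  have key := ae_frequently_dist_le_of_ubiquity hm X hXc δ (fun k => ρ k / 2 ^ (m * k)) hC.le
    (fun k => by positivity) ?_ (fun k => div_nonneg (hρ0 k) (hT k).le) ?_ ?_ ?_
  · filter_upwards [key] with x hx K
    obtain ⟨k, hk, y, ⟨u, hu1, hu2, hu3, hu4, rfl⟩, hxy⟩ := hx K
    refine ⟨k, hk, u, hu1, hu2, hu3, hu4, fun i => ?_⟩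
    have h1 := (dist_le_pi_dist _ _ i).trans hxy
    have h2 : (0 : ℝ) < u (Sum.inr j₀) := (hT k).trans_le hu3
    rw [Real.dist_eq] at h1
    have h3 : blockForm A u i + u (Sum.inr j₀) * x i =
        u (Sum.inr j₀) * (x i - -(blockForm A u i / u (Sum.inr j₀))) := by
      field_simp
      ring
    rw [h3, abs_mul]
    calc _ ≤ (C * 2 ^ (m * k)) * (ρ k / 2 ^ (m * k)) :=
          mul_le_mul (hu4 j₀) h1 (abs_nonneg _) (by positivity)
      _ = C * ρ k := by field_simp
  · intro k l hkl
    simp only [hδ]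
    rw [← pow_add]
    refine pow_le_pow_of_le_one (by norm_num) (by norm_num) ?_
    obtain ⟨t, rfl⟩ := Nat.exists_eq_add_of_le hkl
    rw [Nat.add_sub_cancel_left, mul_add, add_comm]
    exact Nat.add_le_add_left (Nat.le_mul_of_pos_left t (by omega)) _
  · intro k
    rw [div_le_iff₀ (hT k), hδ']
    exact hρ1 k
  · intro z R hR
    obtain ⟨k₀, hk₀⟩ := exists_volume_short_vector_le hm hn A j₀ hA z hR
    refine ⟨k₀, fun k hk => ?_⟩
    have h1 := hk₀ k hk
    rw [← volumeReal_closedBall_pi z hR.le] at h1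
    set Bad := {x ∈ Metric.closedBall z R | ∃ u : Fin m ⊕ Fin n → ℤ, u ≠ 0 ∧
        (∀ i, |blockForm A u i + u (Sum.inr j₀) * x i| < 1 / 12 * (1 / 2) ^ (n * k)) ∧
        ∀ j, |(u (Sum.inr j) : ℝ)| < 1 / 12 * 2 ^ (m * k)} with hBad
    set Good := {x ∈ Metric.closedBall z R | ∃ y ∈ X k, dist x y ≤ C * δ k} with hGood
    have hfin : volume (Metric.closedBall z R) ≠ ⊤ := (isCompact_closedBall z R).measure_lt_top.ne
    have hcover : Metric.closedBall z R ⊆ Good ∪ Bad := by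
      intro x hx
      by_cases hxB : x ∈ Bad
      · exact Or.inr hxB
      · left
        obtain ⟨u, hu1, hu2, hu3, hu4, hu5⟩ := hnear A a ha k x (fun h => hxB ⟨hx, h⟩)
        refine ⟨hx, _, ⟨u, hu1, hu2, hu3, hu4, rfl⟩, ?_⟩
        rw [dist_pi_le_iff (by positivity)]
        intro i
        have h2 : (0 : ℝ) < u (Sum.inr j₀) := (hT k).trans_le hu3
        have h3 : blockForm A u i + u (Sum.inr j₀) * x i =
            (x i - -(blockForm A u i / u (Sum.inr j₀))) * u (Sum.inr j₀) := by
          field_simp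
          ring
        have h4 := hu5 i
        rw [h3, abs_mul, abs_of_pos h2, ← hδ'] at h4
        rw [Real.dist_eq]
        have h5 : |x i - -(blockForm A u i / u (Sum.inr j₀))| * 2 ^ (m * k) ≤
            C * δ k * 2 ^ (m * k) := by
          calc _ ≤ |x i - -(blockForm A u i / u (Sum.inr j₀))| * u (Sum.inr j₀) := by gcongr
            _ ≤ _ := by linarith
        exact le_of_mul_le_mul_right h5 (hT k)
    have h2 := (measureReal_mono hcover (measure_ne_top_of_subset
      (union_subset (sep_subset _ _) (sep_subset _ _)) hfin)).trans
      (measureReal_union_le (μ := volume) Good Bad)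
    linarith
  · convert hdiv using 4 with k
    rw [div_div, mul_comm _ (δ k), hδ', div_eq_mul_inv]
    congr 1
    rw [← inv_pow]
    norm_num

/-- Cauchy condensation for the divergence of `∫ ψ`, with truncation and shift. -/
lemma not_summable_condensed {ψ : ℝ → ℝ} (hψpos : ∀ x ∈ Ici (1 : ℝ), 0 < ψ x)
    (hψanti : AntitoneOn ψ (Ici (1 : ℝ))) (hdiv : ∫⁻ x in Ici (1 : ℝ), ENNReal.ofReal (ψ x) = ⊤)
    {R : ℝ} (hR : 1 < R) (j : ℕ) :
    ¬ Summable (fun k : ℕ => min (R ^ k * ψ (R ^ (k + j))) 1) := by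
  intro hsum
  have hR0 : 0 < R := by linarith
  have hRk : ∀ k : ℕ, (1 : ℝ) ≤ R ^ k := fun k => one_le_pow₀ hR.le
  have h1 : Summable (fun k : ℕ => R ^ k * ψ (R ^ (k + j))) := by
    have hev : ∀ᶠ k : ℕ in Filter.atTop, min (R ^ k * ψ (R ^ (k + j))) 1 < 1 :=
      hsum.tendsto_atTop_zero.eventually_lt_const one_pos
    obtain ⟨k₀, hk₀⟩ := Filter.eventually_atTop.mp hev
    rw [← summable_nat_add_iff k₀] at hsum ⊢
    refine hsum.congr fun k => ?_
    have h2 := hk₀ (k + k₀) (by omega)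
    rw [min_lt_iff] at h2
    exact min_eq_left (h2.resolve_right (lt_irrefl _)).le
  have h2 : Summable (fun k : ℕ => R ^ k * ψ (R ^ k)) := by
    rw [← summable_nat_add_iff j]
    refine (h1.mul_left (R ^ j)).congr fun k => ?_
    rw [pow_add]
    ring
  have h3 : Summable (fun k : ℕ => (R - 1) * (R ^ k * ψ (R ^ k))) := h2.mul_left _
  have hcov : Ici (1 : ℝ) ⊆ ⋃ k : ℕ, Ico (R ^ k) (R ^ (k + 1)) := by
    intro x hx
    obtain ⟨k, hk⟩ := exists_nat_pow_near hx hR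
    exact mem_iUnion.mpr ⟨k, hk⟩
  have hle : ∫⁻ x in Ici (1 : ℝ), ENNReal.ofReal (ψ x) ≤
      ∑' k : ℕ, ENNReal.ofReal ((R - 1) * (R ^ k * ψ (R ^ k))) := by
    refine (lintegral_mono_set hcov).trans ((lintegral_iUnion_le _ _).trans ?_)
    refine ENNReal.tsum_le_tsum fun k => ?_
    calc ∫⁻ x in Ico (R ^ k) (R ^ (k + 1)), ENNReal.ofReal (ψ x)
        ≤ ∫⁻ _ in Ico (R ^ k) (R ^ (k + 1)), ENNReal.ofReal (ψ (R ^ k)) := by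
          refine setLIntegral_mono measurable_const fun x hx => ?_
          exact ENNReal.ofReal_le_ofReal (hψanti (hRk k) ((hRk k).trans hx.1) hx.1)
      _ = ENNReal.ofReal (ψ (R ^ k)) * ENNReal.ofReal (R ^ (k + 1) - R ^ k) := by
          rw [setLIntegral_const, Real.volume_Ico]
      _ = ENNReal.ofReal ((R - 1) * (R ^ k * ψ (R ^ k))) := by
          rw [← ENNReal.ofReal_mul (hψpos _ (hRk k)).le]
          congr 1
          ring
  rw [hdiv, top_le_iff] at hle
  exact h3.tsum_ofReal_ne_top hle

lemma exists_norm_mulVec_le {α β : Type*} [Fintype α] [Fintype β] [DecidableEq β]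
    (M : Matrix α β ℝ) : ∃ K : ℝ, 0 < K ∧ ∀ y, ‖M.mulVec y‖ ≤ K * ‖y‖ := by
  set f := (Matrix.toLin' M).toContinuousLinearMap with hf
  refine ⟨‖f‖ + 1, by positivity, fun y => ?_⟩
  have h1 := f.le_opNorm y
  have h2 : f y = M.mulVec y := by simp [hf]
  rw [h2] at h1
  nlinarith [norm_nonneg y]

/-- There are primitive vectors `u ≡ a` whose images `(v, w)` under `g` have `‖w‖` arbitrarily large
and satisfy `‖v‖ ^ m ≤ ψ (‖w‖ ^ n)`. -/
def IsApproximable (m n N : ℕ) (ψ : ℝ → ℝ) (a : Fin m ⊕ Fin n → ℤ)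
    (g : Matrix (Fin m ⊕ Fin n) (Fin m ⊕ Fin n) ℝ) : Prop :=
  ∀ M : ℕ, ∃ u : Fin m ⊕ Fin n → ℤ, IsPrimitiveVec u ∧ (∀ i, u i ≡ a i [ZMOD N]) ∧
    (M : ℝ) < ‖fun j => g.mulVec (fun i => (u i : ℝ)) (Sum.inr j)‖ ∧
    ‖fun j => g.mulVec (fun i => (u i : ℝ)) (Sum.inl j)‖ ^ m ≤
      ψ (max (‖fun j => g.mulVec (fun i => (u i : ℝ)) (Sum.inr j)‖ ^ n) 1)

/-- The unipotent matrix adding multiples of coordinate `j₀` of the lower block to the upper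
block. -/
def shear {m n : ℕ} (j₀ : Fin n) (x : Fin m → ℝ) : Matrix (Fin m ⊕ Fin n) (Fin m ⊕ Fin n) ℝ :=
  Matrix.fromBlocks 1 (Matrix.of fun i j => if j = j₀ then x i else 0) 0 1

lemma det_shear {m n : ℕ} (j₀ : Fin n) (x : Fin m → ℝ) : (shear j₀ x).det = 1 := by
  rw [shear, Matrix.det_fromBlocks_zero₂₁, Matrix.det_one, Matrix.det_one, mul_one]

lemma shear_mulVec {m n : ℕ} (j₀ : Fin n) (x : Fin m → ℝ) (y : Fin m ⊕ Fin n → ℝ) :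
    (shear j₀ x).mulVec y =
      Sum.elim (fun i => y (Sum.inl i) + y (Sum.inr j₀) * x i) (fun j => y (Sum.inr j)) := by
  rw [shear, Matrix.fromBlocks_mulVec, Matrix.one_mulVec, Matrix.one_mulVec, Matrix.zero_mulVec,
    zero_add]
  congr 1
  ext i
  simp only [Pi.add_apply, Function.comp_apply, Matrix.mulVec, dotProduct, Matrix.of_apply, ite_mul,
    zero_mul, Finset.sum_ite_eq', Finset.mem_univ, if_true]
  rw [mul_comm]

/-- The upper block of `g * shear j₀ x` in terms of the normalized form. -/
lemma mul_shear_mulVec_inl {m n : ℕ} {g : Matrix (Fin m ⊕ Fin n) (Fin m ⊕ Fin n) ℝ}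
    (hg : g.toBlocks₁₁.det ≠ 0) (j₀ : Fin n) (x : Fin m → ℝ) (u : Fin m ⊕ Fin n → ℤ) :
    (fun i => (g * shear j₀ x).mulVec (fun i => (u i : ℝ)) (Sum.inl i)) =
      g.toBlocks₁₁.mulVec
        (fun i => blockForm (g.toBlocks₁₁⁻¹ * g.toBlocks₁₂) u i + u (Sum.inr j₀) * x i) := by
  have h1 : (fun i => blockForm (g.toBlocks₁₁⁻¹ * g.toBlocks₁₂) u i + u (Sum.inr j₀) * x i) =
      (fun i => (u (Sum.inl i) : ℝ) + u (Sum.inr j₀) * x i) +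
        (g.toBlocks₁₁⁻¹ * g.toBlocks₁₂).mulVec (fun j => (u (Sum.inr j) : ℝ)) := by
    ext i
    simp only [blockForm, Pi.add_apply]
    ring
  rw [h1, Matrix.mulVec_add, Matrix.mulVec_mulVec, ← Matrix.mul_assoc,
    Matrix.mul_nonsing_inv _ (isUnit_iff_ne_zero.mpr hg), Matrix.one_mul]
  ext i
  rw [← Matrix.mulVec_mulVec, shear_mulVec]
  nth_rewrite 1 [← Matrix.fromBlocks_toBlocks g]
  rw [Matrix.fromBlocks_mulVec, Sum.elim_inl]
  rfl

theorem ae_isApproximable_mul_shear {m n N : ℕ} (hm : 0 < m) (hN : 0 < N) {ψ : ℝ → ℝ}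
    (hψpos : ∀ x ∈ Ici (1 : ℝ), 0 < ψ x)
    (hψanti : AntitoneOn ψ (Ici (1 : ℝ)))
    (hdiv : ∫⁻ x in Ici (1 : ℝ), ENNReal.ofReal (ψ x) = ⊤)
    {g : Matrix (Fin m ⊕ Fin n) (Fin m ⊕ Fin n) ℝ} (hdet : g.det = 1)
    (hg : g.toBlocks₁₁.det ≠ 0) (j₀ : Fin n)
    (hgen : IsGenericAt (g.toBlocks₁₁⁻¹ * g.toBlocks₁₂) j₀) {a : Fin m ⊕ Fin n → ℤ}
    (ha : IsPrimitiveVec a) :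
    ∀ᵐ x : Fin m → ℝ, IsApproximable m n N ψ a (g * shear j₀ x) := by
  have hn : 0 < n := j₀.pos
  obtain ⟨C, hC, hae⟩ := ae_frequently_primitive_approx (N := N) hm hN j₀
  set A := g.toBlocks₁₁⁻¹ * g.toBlocks₁₂ with hA
  obtain ⟨K₁, hK₁, hK₁'⟩ := exists_norm_mulVec_le g.toBlocks₁₁
  obtain ⟨K₂, hK₂, hK₂'⟩ := exists_norm_mulVec_le A
  obtain ⟨K₃, hK₃, hK₃'⟩ := exists_norm_mulVec_le g
  obtain ⟨K₄, hK₄, hK₄'⟩ := exists_norm_mulVec_le g⁻¹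
  set κ : ℝ := 1 / (K₁ * C + C + 1) with hκ
  have hκ0 : 0 < κ := by positivity
  have hκ1 : κ ≤ 1 := by
    rw [hκ, div_le_one (by positivity)]
    nlinarith [mul_pos hK₁ hC]
  have hκC : C * κ ≤ 1 := by
    rw [hκ, mul_one_div, div_le_one (by positivity)]
    nlinarith [mul_pos hK₁ hC]
  have hκKC : K₁ * (C * κ) ≤ 1 := by
    rw [hκ, mul_one_div, ← mul_div_assoc, div_le_one (by positivity)]
    nlinarith [mul_pos hK₁ hC]
  set K₅ : ℝ := K₃ * (1 + K₂ * C + C) with hK₅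
  have hK₅0 : 0 < K₅ := by positivity
  set R : ℝ := 2 ^ (m * n) with hR
  have hR1 : 1 < R := one_lt_pow₀ (by norm_num) (by positivity)
  have hRk : ∀ k : ℕ, (1 : ℝ) ≤ R ^ k := fun k => one_le_pow₀ hR1.le
  obtain ⟨j, hj⟩ := pow_unbounded_of_one_lt (K₅ ^ n) hR1
  set ρ : ℕ → ℝ := fun k => κ * min (ψ (R ^ (k + j)) ^ (1 / m : ℝ)) ((1 / 2) ^ (n * k)) with hρ
  have hψk : ∀ k, 0 < ψ (R ^ (k + j)) := fun k => hψpos _ (hRk _)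
  have hmin0 : ∀ k, 0 ≤ min (ψ (R ^ (k + j)) ^ (1 / m : ℝ)) ((1 / 2) ^ (n * k)) := fun k =>
    le_min (Real.rpow_nonneg (hψk k).le _) (by positivity)
  have hroot : ∀ k, (ψ (R ^ (k + j)) ^ (1 / m : ℝ)) ^ m = ψ (R ^ (k + j)) := by
    intro k
    rw [one_div, Real.rpow_inv_natCast_pow (hψk k).le hm.ne']
  have hx := hae A hgen a ha ρ (fun k => mul_nonneg hκ0.le (hmin0 k))
    (fun k => (mul_le_of_le_one_left (hmin0 k) hκ1).trans (min_le_right _ _)) (by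
      intro hsum
      refine not_summable_condensed hψpos hψanti hdiv hR1 j ?_
      refine (hsum.mul_left (κ ^ m)⁻¹).congr fun k => ?_
      have h1 : (2 : ℝ) ^ (n * k) * (1 / 2) ^ (n * k) = 1 := by
        rw [← mul_pow]
        norm_num
      have h2 : ((2 : ℝ) ^ (n * k)) ^ m = R ^ k := by
        rw [hR, ← pow_mul, ← pow_mul]
        congr 1
        ring
      have h3 : min (ψ (R ^ (k + j)) ^ (1 / m : ℝ)) ((1 / 2) ^ (n * k)) * 2 ^ (n * k) =
          min (2 ^ (n * k) * ψ (R ^ (k + j)) ^ (1 / m : ℝ)) 1 := by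
        rw [mul_comm, mul_min_of_nonneg _ _ (by positivity), h1]
      have h4 : 0 ≤ (2 : ℝ) ^ (n * k) * ψ (R ^ (k + j)) ^ (1 / m : ℝ) :=
        mul_nonneg (by positivity) (Real.rpow_nonneg (hψk k).le _)
      simp only [hρ]
      rw [mul_assoc, h3, mul_pow, inv_mul_cancel_left₀ (by positivity)]
      have h5 : R ^ k * ψ (R ^ (k + j)) = (2 ^ (n * k) * ψ (R ^ (k + j)) ^ (1 / m : ℝ)) ^ m := by
        rw [mul_pow, h2, hroot]
      rw [h5]
      rcases le_total ((2 : ℝ) ^ (n * k) * ψ (R ^ (k + j)) ^ (1 / m : ℝ)) 1 with h | h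
      · rw [min_eq_left h, min_eq_left (pow_le_one₀ h4 h)]
      · rw [min_eq_right h, min_eq_right (one_le_pow₀ h), one_pow])
  filter_upwards [hx] with x hx M
  obtain ⟨k₀, hk₀⟩ := pow_unbounded_of_one_lt (K₄ * (M + 1)) (one_lt_two (α := ℝ))
  obtain ⟨k, hk, u, hu1, hu2, hu3, hu4, hu5⟩ := hx k₀
  have hMT : K₄ * (M + 1) < 2 ^ (m * k) :=
    hk₀.trans_le (pow_le_pow_right₀ (by norm_num) (hk.trans (Nat.le_mul_of_pos_left k hm)))
  set T : ℝ := 2 ^ (m * k) with hT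
  have hT1 : 1 ≤ T := one_le_pow₀ (by norm_num)
  set y : Fin m ⊕ Fin n → ℝ := fun i => (u i : ℝ) with hy
  set v : Fin m → ℝ := fun i => (g * shear j₀ x).mulVec y (Sum.inl i) with hv
  set w : Fin n → ℝ := fun j => (g * shear j₀ x).mulVec y (Sum.inr j) with hw
  have hρ1 : C * ρ k ≤ 1 := by
    have h1 : min (ψ (R ^ (k + j)) ^ (1 / m : ℝ)) ((1 / 2) ^ (n * k)) ≤ 1 :=
      (min_le_right _ _).trans (pow_le_one₀ (by norm_num) (by norm_num))
    simp only [hρ]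
    rw [← mul_assoc]
    exact mul_le_one₀ hκC (hmin0 k) h1
  have hρ0 : 0 ≤ C * ρ k := mul_nonneg hC.le (mul_nonneg hκ0.le (hmin0 k))
  have hform : ‖fun i => blockForm A u i + u (Sum.inr j₀) * x i‖ ≤ C * ρ k :=
    (pi_norm_le_iff_of_nonneg hρ0).mpr hu5
  have hvle : ‖v‖ ≤ min (ψ (R ^ (k + j)) ^ (1 / m : ℝ)) ((1 / 2) ^ (n * k)) := by
    rw [hv, hy, mul_shear_mulVec_inl hg]
    refine (hK₁' _).trans ?_
    calc K₁ * _ ≤ K₁ * (C * ρ k) := by gcongr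
      _ = (K₁ * (C * κ)) * min (ψ (R ^ (k + j)) ^ (1 / m : ℝ)) ((1 / 2) ^ (n * k)) := by
          simp only [hρ]
          ring
      _ ≤ _ := mul_le_of_le_one_left (hmin0 k) hκKC
  have hv1 : ‖v‖ ≤ 1 :=
    hvle.trans ((min_le_right _ _).trans (pow_le_one₀ (by norm_num) (by norm_num)))
  have hnorm_le : ∀ z : Fin m ⊕ Fin n → ℝ, ∀ B : ℝ, 0 ≤ B → (∀ i, |z (Sum.inl i)| ≤ B) →
      (∀ j, |z (Sum.inr j)| ≤ B) → ‖z‖ ≤ B := by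
    intro z B hB h1 h2
    rw [pi_norm_le_iff_of_nonneg hB]
    rintro (i | j)
    · exact h1 i
    · exact h2 j
  have hq : ‖fun j => y (Sum.inr j)‖ ≤ C * T := (pi_norm_le_iff_of_nonneg (by positivity)).mpr hu4
  have hshear : ‖(shear j₀ x).mulVec y‖ ≤ (1 + K₂ * C + C) * T := by
    refine hnorm_le _ _ (by positivity) (fun i => ?_) (fun j => ?_)
    · rw [shear_mulVec, Sum.elim_inl]
      have h1 : y (Sum.inl i) + y (Sum.inr j₀) * x i =
          (blockForm A u i + u (Sum.inr j₀) * x i) - A.mulVec (fun j => y (Sum.inr j)) i := by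
        simp only [blockForm, hy]
        ring
      have h2 : |A.mulVec (fun j => y (Sum.inr j)) i| ≤ K₂ * (C * T) :=
        (norm_le_pi_norm (A.mulVec (fun j => y (Sum.inr j))) i).trans
          ((hK₂' _).trans (by gcongr))
      rw [h1]
      refine (abs_sub _ _).trans ?_
      have h3 := (hu5 i).trans hρ1
      nlinarith [mul_pos hC (by linarith : 0 < T)]
    · rw [shear_mulVec, Sum.elim_inr]
      have h1 := hu4 j
      have h2 : 0 < K₂ * C * T := by positivity
      simp only [hy]
      nlinarith
  have hwle : ‖w‖ ≤ K₅ * T := by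
    have h1 : ‖w‖ ≤ ‖(g * shear j₀ x).mulVec y‖ :=
      (pi_norm_le_iff_of_nonneg (norm_nonneg _)).mpr fun j =>
        norm_le_pi_norm ((g * shear j₀ x).mulVec y) (Sum.inr j)
    refine h1.trans ?_
    rw [← Matrix.mulVec_mulVec, hK₅, mul_assoc]
    exact (hK₃' _).trans (by gcongr)
  have hMw : (M : ℝ) < ‖w‖ := by
    by_contra! hle
    have h1 : ‖(g * shear j₀ x).mulVec y‖ ≤ M + 1 := by
      refine hnorm_le _ _ (by positivity) (fun i => ?_) (fun j => ?_)
      · have h2 := (norm_le_pi_norm v i).trans hv1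
        have h3 : (0 : ℝ) ≤ M := Nat.cast_nonneg M
        exact h2.trans (by linarith)
      · exact (norm_le_pi_norm w j).trans (by linarith)
    have h2 : (shear j₀ x).mulVec y = g⁻¹.mulVec ((g * shear j₀ x).mulVec y) := by
      rw [Matrix.mulVec_mulVec, ← Matrix.mul_assoc,
        Matrix.nonsing_inv_mul _ (by rw [hdet]; exact isUnit_one), Matrix.one_mul]
    have h3 : T ≤ ‖(shear j₀ x).mulVec y‖ := by
      have h4 := norm_le_pi_norm ((shear j₀ x).mulVec y) (Sum.inr j₀)
      rw [shear_mulVec, Sum.elim_inr] at h4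
      rw [shear_mulVec]
      exact (hu3.trans (le_abs_self _)).trans h4
    have h4 : ‖(shear j₀ x).mulVec y‖ ≤ K₄ * (M + 1) := by
      rw [h2]
      exact (hK₄' _).trans (by gcongr)
    linarith
  refine ⟨u, hu1, hu2, hMw, ?_⟩
  have hvm : ‖v‖ ^ m ≤ ψ (R ^ (k + j)) := by
    rw [← hroot k]
    exact pow_le_pow_left₀ (norm_nonneg _) (hvle.trans (min_le_left _ _)) m
  refine hvm.trans (hψanti (mem_Ici.mpr (le_max_right _ _)) (hRk _) (max_le ?_ (hRk _)))
  calc ‖w‖ ^ n ≤ (K₅ * T) ^ n := pow_le_pow_left₀ (norm_nonneg _) hwle n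
    _ = K₅ ^ n * R ^ k := by
        rw [mul_pow, hT, hR, ← pow_mul, ← pow_mul]
        congr 2
        ring
    _ ≤ R ^ j * R ^ k := by gcongr
    _ = R ^ (k + j) := by rw [pow_add, mul_comm]

lemma ae_eventually_lt_norm_blockForm {m n : ℕ} (hm : 0 < m) (A : Matrix (Fin m) (Fin n) ℝ)
    {j₀ j : Fin n} :
    ∀ᵐ x : Fin m → ℝ, ∃ k₀ : ℕ, ∀ k ≥ k₀, ∀ u : Fin m ⊕ Fin n → ℤ, u (Sum.inr j) ≠ 0 →
      u (Sum.inr j₀) = 0 → (∀ i, |(u (Sum.inr i) : ℝ)| ≤ 2 ^ (m * k)) →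
      (1 / 2 : ℝ) ^ (n * k) < ‖fun i => blockForm A u i + u (Sum.inr j) * x i‖ := by
  have hn : 0 < n := j.pos
  set S : ℕ → ℕ → Set (Fin m → ℝ) := fun r k => {x ∈ Metric.closedBall 0 (r : ℝ) |
    ∃ u : Fin m ⊕ Fin n → ℤ, u (Sum.inr j) ≠ 0 ∧ u (Sum.inr j₀) = 0 ∧
      (∀ i, |(u (Sum.inr i) : ℝ)| ≤ 2 ^ (m * (k + 1))) ∧
      ∀ i, |blockForm A u i + u (Sum.inr j) * x i| ≤ (1 / 2) ^ (n * (k + 1))} with hS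
  have hmeas : ∀ r k : ℕ, volume (S r k) ≤
      ENNReal.ofReal ((3 ^ (n - 1) * (2 * (2 * r + 2)) ^ m) * (1 / 2) ^ k) := by
    intro r k
    set T : ℕ := 2 ^ (m * (k + 1)) with hT
    set ε : ℝ := (1 / 2) ^ (n * (k + 1)) with hε
    have hε0 : 0 < ε := by positivity
    have hε2 : ε ≤ 1 / 2 := pow_le_of_le_one (by norm_num) (by norm_num) (by positivity)
    have hT1 : (1 : ℝ) ≤ T := by exact_mod_cast Nat.one_le_two_pow
    have hTε : ε ^ m * (T : ℝ) ^ n = 1 := by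
      rw [hT, hε]
      push_cast
      rw [← pow_mul, ← pow_mul, show n * (k + 1) * m = m * (k + 1) * n by ring, ← mul_pow]
      norm_num
    set Q : Finset (Fin n → ℤ) := Fintype.piFinset
      (fun i => if i = j₀ then {0} else Finset.Icc (-(T : ℤ)) T) with hQ
    set V : (Fin n → ℤ) → Set (Fin m → ℝ) := fun q => if q j = 0 then ∅ else
      {x ∈ Metric.closedBall 0 (r : ℝ) | ∃ p : Fin m → ℤ, ∀ i,
        |p i + A.mulVec (fun j => (q j : ℝ)) i + (q j : ℝ) * x i| ≤ ε} with hV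
    have hVf : ∀ q, volume (V q) ≤ ENNReal.ofReal (((2 * r + 2) * (2 * ε)) ^ m) := by
      intro q
      by_cases hq : q j = 0
      · simp [hV, hq]
      · simp only [hV, hq, if_false]
        refine (volume_pi_near_int_le (Int.cast_ne_zero.mpr hq) hε0 hε2 (Nat.cast_nonneg r)
          0 (fun i => A.mulVec (fun j => (q j : ℝ)) i)).trans ?_
        refine ENNReal.ofReal_le_ofReal (pow_le_pow_left₀ (by positivity) ?_ m)
        have hs1 : (1 : ℝ) ≤ |(q j : ℝ)| := by
          rw [← Int.cast_abs]
          exact_mod_cast Int.one_le_abs hq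
        have h1 : (2 * r * |(q j : ℝ)| + 2) * (2 * ε / |(q j : ℝ)|) =
            (2 * r + 2 / |(q j : ℝ)|) * (2 * ε) := by
          field_simp
        rw [h1]
        have h2 : 2 / |(q j : ℝ)| ≤ 2 := by
          rw [div_le_iff₀ (by linarith)]
          linarith
        gcongr
    have hsub : S r k ⊆ ⋃ q ∈ Q, V q := by
      rintro x ⟨hx, u, hu0, hu1, hu2, hu3⟩
      simp only [mem_iUnion]
      refine ⟨fun i => u (Sum.inr i), ?_, ?_⟩
      · rw [hQ, Fintype.mem_piFinset]
        intro i
        by_cases hi : i = j₀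
        · simp [hi, hu1]
        · simp only [hi, if_false, Finset.mem_Icc]
          rw [← abs_le]
          have h1 := hu2 i
          rw [← Int.cast_abs] at h1
          exact_mod_cast h1
      · simp only [hV, hu0, if_false]
        exact ⟨hx, fun i => u (Sum.inl i), hu3⟩
    have hcard : (Q.card : ℝ) ≤ (3 * T) ^ (n - 1) := by
      have h1 : Q.card = (2 * T + 1) ^ (n - 1) := by
        rw [hQ, Fintype.card_piFinset, ← Finset.mul_prod_erase Finset.univ _ (Finset.mem_univ j₀)]
        simp only [if_true, Finset.card_singleton, one_mul]
        rw [Finset.prod_congr rfl (g := fun _ => 2 * T + 1), Finset.prod_const,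
          Finset.card_erase_of_mem (Finset.mem_univ _), Finset.card_univ, Fintype.card_fin]
        intro i hi
        rw [if_neg (Finset.ne_of_mem_erase hi), Int.card_Icc]
        omega
      rw [h1]
      push_cast
      refine pow_le_pow_left₀ (by positivity) ?_ _
      linarith
    refine (measure_mono hsub).trans ((measure_biUnion_finset_le _ _).trans ?_)
    refine (Finset.sum_le_sum fun q _ => hVf q).trans ?_
    rw [Finset.sum_const, nsmul_eq_mul, ← ENNReal.ofReal_natCast,
      ← ENNReal.ofReal_mul (Nat.cast_nonneg _)]
    refine ENNReal.ofReal_le_ofReal ?_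
    have hTn : (T : ℝ) * (T : ℝ) ^ (n - 1) = (T : ℝ) ^ n := by
      rw [← pow_succ', Nat.sub_add_cancel hn]
    have hTinv : ε ^ m * (T : ℝ) ^ (n - 1) ≤ (1 / 2) ^ k := by
      have h1 : ε ^ m * (T : ℝ) ^ (n - 1) * T = 1 := by
        rw [mul_assoc, mul_comm _ (T : ℝ), hTn, hTε]
      have h2 : (2 : ℝ) ^ k ≤ T := by
        rw [hT]
        push_cast
        refine pow_le_pow_right₀ (by norm_num) ?_
        exact (Nat.le_succ k).trans (Nat.le_mul_of_pos_left _ hm)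
      have h3 : (1 / 2 : ℝ) ^ k * 2 ^ k = 1 := by
        rw [← mul_pow]
        norm_num
      have h4 : 0 ≤ ε ^ m * (T : ℝ) ^ (n - 1) := by positivity
      have h5 : (0 : ℝ) < 2 ^ k := by positivity
      nlinarith
    calc (Q.card : ℝ) * ((2 * r + 2) * (2 * ε)) ^ m
        ≤ (3 * T) ^ (n - 1) * ((2 * r + 2) * (2 * ε)) ^ m := by gcongr
      _ = (3 ^ (n - 1) * (2 * (2 * r + 2)) ^ m) * (ε ^ m * (T : ℝ) ^ (n - 1)) := by
          rw [mul_pow (3 : ℝ), show (2 * (r : ℝ) + 2) * (2 * ε) = (2 * (2 * r + 2)) * ε by ring,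
            mul_pow (2 * (2 * (r : ℝ) + 2)) ε]
          ring
      _ ≤ _ := by gcongr
  have hBC : ∀ r : ℕ, ∀ᵐ x : Fin m → ℝ, ∀ᶠ k in Filter.atTop, x ∉ S r k := by
    intro r
    refine ae_eventually_notMem (ne_top_of_le_ne_top ?_ (ENNReal.tsum_le_tsum (hmeas r)))
    refine Summable.tsum_ofReal_ne_top ?_
    exact (summable_geometric_of_lt_one (by norm_num) (by norm_num)).mul_left _
  filter_upwards [ae_all_iff.mpr hBC] with x hx
  obtain ⟨r, hr⟩ := exists_nat_ge ‖x‖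
  obtain ⟨k₀, hk₀⟩ := Filter.eventually_atTop.mp (hx r)
  refine ⟨k₀ + 1, fun k hk u hu0 hu1 hu2 => ?_⟩
  obtain ⟨k', rfl⟩ : ∃ k', k = k' + 1 := ⟨k - 1, by omega⟩
  by_contra! hle
  refine hk₀ k' (by omega) ⟨by simpa using hr, u, hu0, hu1, hu2, ?_⟩
  exact (pi_norm_le_iff_of_nonneg (by positivity)).mp hle

section group

variable {ι : Type*} [Fintype ι] [DecidableEq ι]

lemma specialLinearGroup_isClosedEmbedding_val :
    Topology.IsClosedEmbedding (fun g : SpecialLinearGroup ι ℝ => g.1) :=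
  SpecialLinearGroup.isClosedEmbedding_val

instance : IsTopologicalGroup (SpecialLinearGroup ι ℝ) :=
  SpecialLinearGroup.topologicalGroup

instance : BorelSpace (SpecialLinearGroup ι ℝ) := ⟨rfl⟩

instance : SecondCountableTopology (SpecialLinearGroup ι ℝ) :=
  haveI : SecondCountableTopology (Matrix ι ι ℝ) :=
    inferInstanceAs (SecondCountableTopology (ι → ι → ℝ))
  specialLinearGroup_isClosedEmbedding_val.isEmbedding.secondCountableTopology

instance : LocallyCompactSpace (SpecialLinearGroup ι ℝ) :=
  haveI : LocallyCompactSpace (Matrix ι ι ℝ) :=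
    inferInstanceAs (LocallyCompactSpace (ι → ι → ℝ))
  specialLinearGroup_isClosedEmbedding_val.locallyCompactSpace

lemma SpecialLinearGroup.measurable_apply (i j : ι) :
    Measurable (fun g : SpecialLinearGroup ι ℝ => g.1 i j) := by
  have h : Continuous (fun g : SpecialLinearGroup ι ℝ => g.1 i j) :=
    specialLinearGroup_isClosedEmbedding_val.continuous.matrix_elem i j
  exact h.measurable

end group

lemma measure_eq_zero_of_forall_ae_mul_notMem {G X : Type*} [Group G] [MeasurableSpace G]
    [MeasurableMul₂ G] [MeasurableInv G] {ν : Measure G} [SFinite ν] [ν.IsMulLeftInvariant]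
    [MeasurableSpace X] {μ : Measure X} [SFinite μ] [NeZero μ] {f : X → G} (hf : Measurable f)
    {s : Set G} (hs : MeasurableSet s) (h : ∀ g, ∀ᵐ x ∂μ, g * f x ∉ s) : ν s = 0 := by
  have hm : MeasurableSet {p : G × X | p.1 * f p.2 ∈ s} :=
    (measurable_fst.mul (hf.comp measurable_snd)) hs
  have h1 : ν.prod μ {p : G × X | p.1 * f p.2 ∈ s} = 0 := by
    rw [Measure.measure_prod_null hm]
    refine Filter.Eventually.of_forall fun g => ?_
    have := h g
    rw [ae_iff] at this
    simpa using this
  have h2 : ∀ᵐ x ∂μ, ∀ᵐ g ∂ν, g * f x ∉ s := by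
    have h3 : μ.prod ν {p : X × G | p.2 * f p.1 ∈ s} = 0 := by
      rw [← Measure.prod_swap, Measure.map_apply measurable_swap]
      · exact h1
      · exact (measurable_snd.mul (hf.comp measurable_fst)) hs
    have h4 : ∀ᵐ p ∂(μ.prod ν), p.2 * f p.1 ∉ s := by
      rw [ae_iff]
      simpa using h3
    exact Measure.ae_ae_of_ae_prod h4
  obtain ⟨x, hx⟩ := h2.exists
  rw [ae_iff] at hx
  refine (measure_mul_right_null ν (f x)).1 ?_
  simpa [preimage] using hx

section measurability

variable {m n : ℕ}

lemma SpecialLinearGroup.measurable_det_toBlocks₁₁ :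
    Measurable (fun g : SpecialLinearGroup (Fin m ⊕ Fin n) ℝ => g.1.toBlocks₁₁.det) := by
  have h := (specialLinearGroup_isClosedEmbedding_val (ι := Fin m ⊕ Fin n)).continuous
  have h2 : Continuous
      (fun g : SpecialLinearGroup (Fin m ⊕ Fin n) ℝ => g.1.toBlocks₁₁.det) := by
    refine Continuous.matrix_det ?_
    exact h.matrix_submatrix Sum.inl Sum.inl
  exact h2.measurable

lemma SpecialLinearGroup.measurable_norm_blockForm (u : Fin m ⊕ Fin n → ℤ) :
    Measurable (fun g : SpecialLinearGroup (Fin m ⊕ Fin n) ℝ =>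
      ‖blockForm (g.1.toBlocks₁₁⁻¹ * g.1.toBlocks₁₂) u‖) := by
  have h := (specialLinearGroup_isClosedEmbedding_val (ι := Fin m ⊕ Fin n)).continuous
  have hadj : Continuous
      (fun g : SpecialLinearGroup (Fin m ⊕ Fin n) ℝ => g.1.toBlocks₁₁.adjugate) :=
    (h.matrix_submatrix Sum.inl Sum.inl).matrix_adjugate
  refine Measurable.norm (measurable_pi_lambda _ fun i => ?_)
  simp only [blockForm, mulVec, dotProduct, mul_apply, inv_def, Matrix.smul_apply, smul_eq_mul,
    Ring.inverse_eq_inv', toBlocks₁₂, of_apply]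
  refine measurable_const.add (Finset.measurable_sum _ fun j _ => Measurable.mul_const
    (Finset.measurable_sum _ fun k _ => Measurable.mul (Measurable.mul ?_ ?_) ?_) _)
  · exact SpecialLinearGroup.measurable_det_toBlocks₁₁.inv
  · exact (hadj.matrix_elem i k).measurable
  · exact SpecialLinearGroup.measurable_apply _ _

lemma SpecialLinearGroup.measurable_mulVec (v : Fin m ⊕ Fin n → ℝ) (i : Fin m ⊕ Fin n) :
    Measurable (fun g : SpecialLinearGroup (Fin m ⊕ Fin n) ℝ => g.1.mulVec v i) := by
  simp only [mulVec, dotProduct]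
  exact Finset.measurable_sum _ fun j _ => (SpecialLinearGroup.measurable_apply _ _).mul_const _

lemma measurableSet_isApproximable {N : ℕ} {ψ : ℝ → ℝ} (hψanti : AntitoneOn ψ (Ici (1 : ℝ)))
    (a : Fin m ⊕ Fin n → ℤ) :
    MeasurableSet {g : SpecialLinearGroup (Fin m ⊕ Fin n) ℝ | IsApproximable m n N ψ a g.1} := by
  have hψ : Measurable (fun t : ℝ => ψ (max t 1)) := by
    refine Antitone.measurable fun s t hst => ?_
    exact hψanti (mem_Ici.2 (le_max_right _ _)) (mem_Ici.2 (le_max_right _ _))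
      (max_le_max_right 1 hst)
  have hinl : ∀ u : Fin m ⊕ Fin n → ℤ, Measurable
      (fun g : SpecialLinearGroup (Fin m ⊕ Fin n) ℝ =>
        ‖fun j => g.1.mulVec (fun i => (u i : ℝ)) (Sum.inl j)‖) := fun u =>
    Measurable.norm (measurable_pi_lambda _ fun i => SpecialLinearGroup.measurable_mulVec _ _)
  have hinr : ∀ u : Fin m ⊕ Fin n → ℤ, Measurable
      (fun g : SpecialLinearGroup (Fin m ⊕ Fin n) ℝ =>
        ‖fun j => g.1.mulVec (fun i => (u i : ℝ)) (Sum.inr j)‖) := fun u =>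
    Measurable.norm (measurable_pi_lambda _ fun i => SpecialLinearGroup.measurable_mulVec _ _)
  simp only [IsApproximable, ofPred_forall, ofPred_exists]
  refine MeasurableSet.iInter fun M => MeasurableSet.iUnion fun u => ?_
  refine (MeasurableSet.const _).inter ((MeasurableSet.const _).inter
    ((measurableSet_lt measurable_const (hinr u)).inter
      (measurableSet_le ((hinl u).pow_const m) (hψ.comp ((hinr u).pow_const n)))))

end measurability

/-- The matrix `shear j₀ x` as an element of the special linear group. -/
def shearSL {m n : ℕ} (j₀ : Fin n) (x : Fin m → ℝ) : SpecialLinearGroup (Fin m ⊕ Fin n) ℝ :=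
  ⟨shear j₀ x, det_shear j₀ x⟩

lemma measurable_shearSL {m n : ℕ} (j₀ : Fin n) :
    Measurable (shearSL j₀ : (Fin m → ℝ) → SpecialLinearGroup (Fin m ⊕ Fin n) ℝ) := by
  have h : Continuous (shearSL j₀ : (Fin m → ℝ) → SpecialLinearGroup (Fin m ⊕ Fin n) ℝ) := by
    refine specialLinearGroup_isClosedEmbedding_val.isEmbedding.continuous_iff.2 ?_
    refine Continuous.matrix_fromBlocks continuous_const (continuous_matrix fun i j => ?_)
      continuous_const continuous_const
    by_cases hj : j = j₀
    · simpa [hj] using continuous_apply i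
    · simpa [hj] using continuous_const
  exact h.measurable

lemma toBlocks₁₁_mul_shear {m n : ℕ} (g : Matrix (Fin m ⊕ Fin n) (Fin m ⊕ Fin n) ℝ)
    (j₀ : Fin n) (x : Fin m → ℝ) : (g * shear j₀ x).toBlocks₁₁ = g.toBlocks₁₁ := by
  conv_lhs => rw [← fromBlocks_toBlocks g, shear, fromBlocks_multiply, toBlocks_fromBlocks₁₁]
  simp

lemma toBlocks₁₂_mul_shear {m n : ℕ} (g : Matrix (Fin m ⊕ Fin n) (Fin m ⊕ Fin n) ℝ)
    (j₀ : Fin n) (x : Fin m → ℝ) : (g * shear j₀ x).toBlocks₁₂ =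
      g.toBlocks₁₁ * of (fun i j => if j = j₀ then x i else 0) + g.toBlocks₁₂ := by
  conv_lhs => rw [← fromBlocks_toBlocks g, shear, fromBlocks_multiply, toBlocks_fromBlocks₁₂]
  simp

lemma blockForm_mul_shear {m n : ℕ} {g : Matrix (Fin m ⊕ Fin n) (Fin m ⊕ Fin n) ℝ}
    (hg : g.toBlocks₁₁.det ≠ 0) (j : Fin n) (x : Fin m → ℝ) (u : Fin m ⊕ Fin n → ℤ) :
    blockForm ((g * shear j x).toBlocks₁₁⁻¹ * (g * shear j x).toBlocks₁₂) u =
      fun i => blockForm (g.toBlocks₁₁⁻¹ * g.toBlocks₁₂) u i + u (Sum.inr j) * x i := by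
  rw [toBlocks₁₁_mul_shear, toBlocks₁₂_mul_shear, Matrix.mul_add, ← Matrix.mul_assoc,
    nonsing_inv_mul _ hg.isUnit, Matrix.one_mul]
  ext i
  simp only [blockForm, add_mulVec, Pi.add_apply]
  have : (of (fun i j' => if j' = j then x i else 0) : Matrix (Fin m) (Fin n) ℝ).mulVec
      (fun j => (u (Sum.inr j) : ℝ)) i = u (Sum.inr j) * x i := by
    simp [mulVec, dotProduct, mul_comm]
  rw [this]
  ring

/-- For fixed `j`, the part of `IsGenericAt A j₀` concerning vectors whose `j`-th coordinate is
nonzero. -/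
def IsGenericCoord {m n : ℕ} (A : Matrix (Fin m) (Fin n) ℝ) (j₀ j : Fin n) : Prop :=
  ∃ k₀ : ℕ, ∀ k ≥ k₀, ∀ u : Fin m ⊕ Fin n → ℤ, u (Sum.inr j) ≠ 0 → u (Sum.inr j₀) = 0 →
    (∀ i, |(u (Sum.inr i) : ℝ)| ≤ 2 ^ (m * k)) → (1 / 2 : ℝ) ^ (n * k) < ‖blockForm A u‖

lemma isGenericAt_iff {m n : ℕ} {A : Matrix (Fin m) (Fin n) ℝ} {j₀ : Fin n} :
    IsGenericAt A j₀ ↔ ∀ j, IsGenericCoord A j₀ j := by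
  constructor
  · rintro ⟨k₀, h⟩ j
    exact ⟨k₀, fun k hk u hj h0 hb => h k hk u ⟨j, hj⟩ h0 hb⟩
  · intro h
    choose k₀ hk₀ using h
    refine ⟨Finset.univ.sup k₀, fun k hk u hu h0 hb => ?_⟩
    obtain ⟨j, hj⟩ := hu
    exact hk₀ j k ((Finset.le_sup (Finset.mem_univ j)).trans hk) u hj h0 hb

lemma measurableSet_isGenericCoord {m n : ℕ} (j₀ j : Fin n) :
    MeasurableSet {g : SpecialLinearGroup (Fin m ⊕ Fin n) ℝ |
      IsGenericCoord (g.1.toBlocks₁₁⁻¹ * g.1.toBlocks₁₂) j₀ j} := by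
  simp only [IsGenericCoord, ofPred_forall, ofPred_exists]
  exact MeasurableSet.iUnion fun k₀ => MeasurableSet.iInter fun k => MeasurableSet.iInter fun _ =>
    MeasurableSet.iInter fun u => MeasurableSet.iInter fun _ => MeasurableSet.iInter fun _ =>
    MeasurableSet.iInter fun _ =>
      measurableSet_lt measurable_const (SpecialLinearGroup.measurable_norm_blockForm u)

lemma ae_isGenericAt {m n : ℕ} (hm : 0 < m) (j₀ : Fin n)
    (ν : Measure (SpecialLinearGroup (Fin m ⊕ Fin n) ℝ)) [ν.IsHaarMeasure] :
    ∀ᵐ g ∂ν, g.1.toBlocks₁₁.det ≠ 0 → IsGenericAt (g.1.toBlocks₁₁⁻¹ * g.1.toBlocks₁₂) j₀ := by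
  simp only [isGenericAt_iff]
  have hmain : ∀ j, ∀ᵐ g ∂ν, g.1.toBlocks₁₁.det ≠ 0 →
      IsGenericCoord (g.1.toBlocks₁₁⁻¹ * g.1.toBlocks₁₂) j₀ j := by
    intro j
    rw [ae_iff]
    refine measure_eq_zero_of_forall_ae_mul_notMem (μ := (volume : Measure (Fin m → ℝ)))
      (measurable_shearSL j) ?_ fun g => ?_
    · simp only [Classical.not_imp]
      exact ((SpecialLinearGroup.measurable_det_toBlocks₁₁ (measurableSet_singleton 0)).compl).inter
        (measurableSet_isGenericCoord j₀ j).compl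
    · by_cases hg : g.1.toBlocks₁₁.det = 0
      · refine Filter.Eventually.of_forall fun x hx => hx fun hx2 => (hx2 ?_).elim
        change (g.1 * shear j x).toBlocks₁₁.det = 0
        rwa [toBlocks₁₁_mul_shear]
      · filter_upwards [ae_eventually_lt_norm_blockForm hm (g.1.toBlocks₁₁⁻¹ * g.1.toBlocks₁₂)
          (j₀ := j₀) (j := j)] with x ⟨k₀, hx⟩ hbad
        refine hbad fun _ => ⟨k₀, fun k hk u h1 h2 h3 => ?_⟩
        have := hx k hk u h1 h2 h3
        rwa [← blockForm_mul_shear hg] at this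
  filter_upwards [ae_all_iff.2 hmain] with g hg hdet j using hg j hdet

lemma ae_isApproximable_of_det_ne_zero {m n N : ℕ} (hm : 0 < m) (hn : 0 < n) (hN : 0 < N)
    {ψ : ℝ → ℝ} (hψpos : ∀ x ∈ Ici (1 : ℝ), 0 < ψ x) (hψanti : AntitoneOn ψ (Ici (1 : ℝ)))
    (hdiv : ∫⁻ x in Ici (1 : ℝ), ENNReal.ofReal (ψ x) = ⊤)
    (ν : Measure (SpecialLinearGroup (Fin m ⊕ Fin n) ℝ)) [ν.IsHaarMeasure]
    {a : Fin m ⊕ Fin n → ℤ} (ha : IsPrimitiveVec a) :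
    ∀ᵐ g ∂ν, g.1.toBlocks₁₁.det ≠ 0 → IsApproximable m n N ψ a g.1 := by
  set j₀ : Fin n := ⟨0, hn⟩
  have hmain : ∀ᵐ g ∂ν, g.1.toBlocks₁₁.det ≠ 0 →
      (∀ j, IsGenericCoord (g.1.toBlocks₁₁⁻¹ * g.1.toBlocks₁₂) j₀ j) →
        IsApproximable m n N ψ a g.1 := by
    rw [ae_iff]
    refine measure_eq_zero_of_forall_ae_mul_notMem (μ := (volume : Measure (Fin m → ℝ)))
      (measurable_shearSL j₀) ?_ fun g => ?_
    · simp only [Classical.not_imp]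
      refine ((SpecialLinearGroup.measurable_det_toBlocks₁₁
        (measurableSet_singleton 0)).compl).inter (MeasurableSet.inter ?_
          (measurableSet_isApproximable hψanti a).compl)
      change MeasurableSet {g : SpecialLinearGroup (Fin m ⊕ Fin n) ℝ |
        ∀ j, IsGenericCoord (g.1.toBlocks₁₁⁻¹ * g.1.toBlocks₁₂) j₀ j}
      rw [ofPred_forall]
      exact MeasurableSet.iInter fun j => measurableSet_isGenericCoord j₀ j
    · by_cases hg : g.1.toBlocks₁₁.det = 0
      · refine Filter.Eventually.of_forall fun x hx => hx fun hx2 => (hx2 ?_).elim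
        change (g.1 * shear j₀ x).toBlocks₁₁.det = 0
        rwa [toBlocks₁₁_mul_shear]
      · by_cases hgen : IsGenericAt (g.1.toBlocks₁₁⁻¹ * g.1.toBlocks₁₂) j₀
        · filter_upwards [ae_isApproximable_mul_shear hm hN hψpos hψanti hdiv g.2 hg j₀ hgen ha]
            with x hx hbad
          exact hbad fun _ _ => hx
        · refine Filter.Eventually.of_forall fun x hx => hx fun _ hx2 => (hgen ?_).elim
          rw [isGenericAt_iff]
          intro j
          obtain ⟨k₀, hk₀⟩ := hx2 j
          refine ⟨k₀, fun k hk u h1 h2 h3 => ?_⟩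
          have := hk₀ k hk u h1 h2 h3
          change _ < ‖blockForm ((g.1 * shear j₀ x).toBlocks₁₁⁻¹ *
            (g.1 * shear j₀ x).toBlocks₁₂) u‖ at this
          rw [blockForm_mul_shear hg] at this
          simpa [h2] using this
  filter_upwards [hmain, ae_isGenericAt hm j₀ ν] with g h1 h2 h3
  exact h1 h3 (isGenericAt_iff.1 (h2 h3))

lemma exists_perm_det_submatrix_ne_zero {m n : ℕ} {g : Matrix (Fin m ⊕ Fin n) (Fin m ⊕ Fin n) ℝ}
    (hg : g.det = 1) :
    ∃ π : Equiv.Perm (Fin m ⊕ Fin n), (g.submatrix Sum.inl (π ∘ Sum.inl)).det ≠ 0 := by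
  set v : Fin m ⊕ Fin n → Fin m → ℝ := fun j i => g (Sum.inl i) j with hv
  have hspan : Submodule.span ℝ (range v) = ⊤ := by
    refine eq_top_iff.2 fun y _ => ?_
    set x := g⁻¹.mulVec (Sum.elim y 0) with hx
    have hgx : g.mulVec x = Sum.elim y 0 := by
      rw [hx, mulVec_mulVec, mul_nonsing_inv _ (by simp [hg]), one_mulVec]
    have hy : y = ∑ j, x j • v j := by
      ext i
      have := congrFun hgx (Sum.inl i)
      simp only [mulVec, dotProduct, Sum.elim_inl] at this
      rw [Finset.sum_apply, ← this]
      exact Finset.sum_congr rfl fun j _ => mul_comm _ _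
    rw [hy]
    exact Submodule.sum_mem _ fun j _ =>
      Submodule.smul_mem _ _ (Submodule.subset_span (mem_range_self j))
  obtain ⟨κ, a, ha, hsp, hli⟩ := exists_linearIndependent' ℝ v
  let b := Module.Basis.mk hli (by rw [hsp, hspan])
  let e : Fin m ≃ κ := (Pi.basisFun ℝ (Fin m)).indexEquiv b
  have hf : Function.Injective (a ∘ e) := ha.comp e.injective
  let E : {x : Fin m ⊕ Fin n // x ∈ range (Sum.inl : Fin m → Fin m ⊕ Fin n)} ≃
      {x : Fin m ⊕ Fin n // x ∈ range (a ∘ e)} :=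
    (Equiv.ofInjective _ Sum.inl_injective).symm.trans (Equiv.ofInjective _ hf)
  classical
  refine ⟨E.extendSubtype, ?_⟩
  have hE : ∀ i, E.extendSubtype (Sum.inl i) = a (e i) := by
    intro i
    rw [Equiv.extendSubtype_apply_of_mem E _ (mem_range_self i)]
    have h1 : (⟨Sum.inl i, mem_range_self i⟩ :
        {x : Fin m ⊕ Fin n // x ∈ range (Sum.inl : Fin m → Fin m ⊕ Fin n)}) =
        Equiv.ofInjective _ Sum.inl_injective i := rfl
    simp only [E, Equiv.trans_apply]
    rw [h1, Equiv.symm_apply_apply]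
    rfl
  rw [← isUnit_iff_ne_zero, ← isUnit_iff_isUnit_det, ← linearIndependent_cols_iff_isUnit]
  have h2 : (g.submatrix Sum.inl (E.extendSubtype ∘ Sum.inl)).col = (v ∘ a) ∘ e := by
    ext j i
    simp [hv, hE]
  rw [h2]
  exact hli.comp _ e.injective

lemma exists_int_det_toBlocks₁₁_mul_ne_zero {m n : ℕ} (hn : 0 < n)
    {g : Matrix (Fin m ⊕ Fin n) (Fin m ⊕ Fin n) ℝ} (hg : g.det = 1) :
    ∃ σ : SpecialLinearGroup (Fin m ⊕ Fin n) ℤ,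
      (g * σ.1.map (Int.cast : ℤ → ℝ)).toBlocks₁₁.det ≠ 0 := by
  obtain ⟨π, hπ⟩ := exists_perm_det_submatrix_ne_zero hg
  set D : Fin m ⊕ Fin n → ℤ := Function.update 1 (Sum.inr ⟨0, hn⟩) (Equiv.Perm.sign π : ℤ) with hD
  refine ⟨⟨(1 : Matrix (Fin m ⊕ Fin n) (Fin m ⊕ Fin n) ℤ).submatrix id π * diagonal D, ?_⟩, ?_⟩
  · rw [det_mul, det_permute', det_diagonal, hD, Finset.prod_update_of_mem (Finset.mem_univ _)]
    simp [← Units.val_mul]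
  · convert hπ using 2
    ext i j
    have hσ : ∀ k, ((1 : Matrix (Fin m ⊕ Fin n) (Fin m ⊕ Fin n) ℤ).submatrix id π * diagonal D) k
        (Sum.inl j) = if k = π (Sum.inl j) then 1 else 0 := by
      intro k
      rw [mul_diagonal]
      simp [one_apply, hD]
    simp only [toBlocks₁₁, of_apply, submatrix_apply, mul_apply (M := g), map_apply, hσ,
      Function.comp]
    simp

lemma map_intCast_mulVec {ι : Type*} [Fintype ι] (σ : Matrix ι ι ℤ) (u : ι → ℤ) :
    (σ.map (Int.cast : ℤ → ℝ)).mulVec (fun i => (u i : ℝ)) = fun i => (σ.mulVec u i : ℝ) := by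
  ext i
  simp [mulVec, dotProduct]

lemma adjugate_mulVec_mulVec {ι : Type*} [Fintype ι] [DecidableEq ι] {σ : Matrix ι ι ℤ}
    (hσ : σ.det = 1) (u : ι → ℤ) : σ.adjugate.mulVec (σ.mulVec u) = u := by
  rw [mulVec_mulVec, adjugate_mul, hσ, one_smul, one_mulVec]

lemma mulVec_adjugate_mulVec {ι : Type*} [Fintype ι] [DecidableEq ι] {σ : Matrix ι ι ℤ}
    (hσ : σ.det = 1) (u : ι → ℤ) : σ.mulVec (σ.adjugate.mulVec u) = u := by
  rw [mulVec_mulVec, mul_adjugate, hσ, one_smul, one_mulVec]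

lemma det_adjugate_eq_one {ι : Type*} [Fintype ι] [DecidableEq ι] {σ : Matrix ι ι ℤ}
    (hσ : σ.det = 1) : σ.adjugate.det = 1 := by
  rw [det_adjugate, hσ, one_pow]

lemma IsPrimitiveVec.mulVec {ι : Type*} [Fintype ι] [DecidableEq ι] {σ : Matrix ι ι ℤ}
    (hσ : σ.det = 1) {u : ι → ℤ} (hu : IsPrimitiveVec u) : IsPrimitiveVec (σ.mulVec u) := by
  intro p hp
  by_contra! h
  obtain ⟨i, hi⟩ := hu p hp
  refine hi ?_
  rw [← adjugate_mulVec_mulVec hσ u]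
  exact Finset.dvd_sum fun j _ => (h j).mul_left _

lemma mulVec_modEq {ι : Type*} [Fintype ι] (σ : Matrix ι ι ℤ) {N : ℤ} {u v : ι → ℤ}
    (h : ∀ i, u i ≡ v i [ZMOD N]) (i : ι) : σ.mulVec u i ≡ σ.mulVec v i [ZMOD N] := by
  rw [Int.modEq_iff_dvd]
  simp only [Matrix.mulVec, dotProduct, ← Finset.sum_sub_distrib, ← mul_sub]
  exact Finset.dvd_sum fun j _ => ((Int.modEq_iff_dvd.1 (h j))).mul_left _

lemma IsApproximable.of_mul {m n N : ℕ} {ψ : ℝ → ℝ} {a : Fin m ⊕ Fin n → ℤ}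
    {g : Matrix (Fin m ⊕ Fin n) (Fin m ⊕ Fin n) ℝ}
    {σ : Matrix (Fin m ⊕ Fin n) (Fin m ⊕ Fin n) ℤ} (hσ : σ.det = 1)
    (h : IsApproximable m n N ψ (σ.adjugate.mulVec a) (g * σ.map (Int.cast : ℤ → ℝ))) :
    IsApproximable m n N ψ a g := by
  intro M
  obtain ⟨u, hu, hmod, h1, h2⟩ := h M
  simp only [← mulVec_mulVec, map_intCast_mulVec] at h1 h2
  refine ⟨σ.mulVec u, hu.mulVec hσ, fun i => ?_, h1, h2⟩
  have := mulVec_modEq σ hmod i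
  rwa [mulVec_adjugate_mulVec hσ] at this

lemma ae_forall_isApproximable {m n N : ℕ} (hm : 0 < m) (hn : 0 < n) (hN : 0 < N)
    {ψ : ℝ → ℝ} (hψpos : ∀ x ∈ Ici (1 : ℝ), 0 < ψ x) (hψanti : AntitoneOn ψ (Ici (1 : ℝ)))
    (hdiv : ∫⁻ x in Ici (1 : ℝ), ENNReal.ofReal (ψ x) = ⊤)
    (ν : Measure (SpecialLinearGroup (Fin m ⊕ Fin n) ℝ)) [ν.IsHaarMeasure] :
    ∀ᵐ g ∂ν, ∀ a, IsPrimitiveVec a → IsApproximable m n N ψ a g.1 := by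
  have h1 : ∀ᵐ g ∂ν, ∀ a, IsPrimitiveVec a → g.1.toBlocks₁₁.det ≠ 0 →
      IsApproximable m n N ψ a g.1 := by
    rw [ae_all_iff]
    intro a
    by_cases ha : IsPrimitiveVec a
    · filter_upwards [ae_isApproximable_of_det_ne_zero hm hn hN hψpos hψanti hdiv ν ha]
        with g hg _ using hg
    · exact Filter.Eventually.of_forall fun _ h => (ha h).elim
  have : Countable (SpecialLinearGroup (Fin m ⊕ Fin n) ℤ) :=
    have : Countable (Matrix (Fin m ⊕ Fin n) (Fin m ⊕ Fin n) ℤ) :=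
      inferInstanceAs (Countable (Fin m ⊕ Fin n → Fin m ⊕ Fin n → ℤ))
    Subtype.val_injective.countable
  have h2 : ∀ᵐ g ∂ν, ∀ σ : SpecialLinearGroup (Fin m ⊕ Fin n) ℤ, ∀ a, IsPrimitiveVec a →
      (g.1 * σ.1.map (Int.cast : ℤ → ℝ)).toBlocks₁₁.det ≠ 0 →
        IsApproximable m n N ψ a (g.1 * σ.1.map (Int.cast : ℤ → ℝ)) := by
    rw [ae_all_iff]
    intro σ
    exact (quasiMeasurePreserving_mul_right ν
      (SpecialLinearGroup.map (Int.castRingHom ℝ) σ)).ae h1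
  filter_upwards [h2] with g hg a ha
  obtain ⟨σ, hσ⟩ := exists_int_det_toBlocks₁₁_mul_ne_zero hn g.2
  exact IsApproximable.of_mul σ.2 (hg σ _ (ha.mulVec (det_adjugate_eq_one σ.2)) hσ)

lemma IsPrimitiveVec.exists_sum_mul_eq_one {ι : Type*} [Fintype ι] {u : ι → ℤ}
    (hu : IsPrimitiveVec u) : ∃ c : ι → ℤ, ∑ i, u i * c i = 1 := by
  obtain ⟨c, hc⟩ := Finset.gcd_eq_sum_mul Finset.univ u
  have hg : IsUnit (Finset.univ.gcd u) := by
    rw [Int.isUnit_iff_natAbs_eq]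
    by_contra h0
    obtain ⟨p, hp, hpd⟩ := Nat.exists_prime_and_dvd h0
    obtain ⟨i, hi⟩ := hu p hp
    exact hi ((Int.natCast_dvd.2 hpd).trans (Finset.gcd_dvd (Finset.mem_univ i)))
  refine ⟨c, ?_⟩
  rw [← hc, ← Finset.normalize_gcd, normalize_eq_one]
  exact hg

lemma IsPrimitiveVec.exists_basis {ι : Type*} [Fintype ι] {u : ι → ℤ} (hu : IsPrimitiveVec u)
    (i₀ : ι) : ∃ b : Module.Basis ι ℤ (ι → ℤ), b i₀ = u := by
  classical
  obtain ⟨c, hc⟩ := hu.exists_sum_mul_eq_one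
  let f : (ι → ℤ) →ₗ[ℤ] ℤ := ∑ i, c i • LinearMap.proj i
  have hf : ∀ v, f v = ∑ i, v i * c i := fun v => by simp [f, mul_comm]
  obtain ⟨k, ⟨b⟩⟩ := Submodule.nonempty_basis_of_pid (Pi.basisFun ℤ ι) (LinearMap.ker f)
  let B : Module.Basis (Fin (k + 1)) ℤ (ι → ℤ) := Module.Basis.mkFinCons u b
    (fun r x hx h => by
      have := congrArg f h
      rw [map_add, map_smul, LinearMap.mem_ker.1 hx, hf u, hc] at this
      simpa using this)
    (fun z => ⟨-f z, by
      rw [LinearMap.mem_ker, map_add, map_smul, hf u, hc]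
      simp⟩)
  have hB : B 0 = u := by
    simp [B]

  refine ⟨B.reindex ((B.indexEquiv (Pi.basisFun ℤ ι)).setValue 0 i₀), ?_⟩
  rw [Module.Basis.reindex_apply, (Equiv.symm_apply_eq _).2 (Equiv.setValue_eq _ _ _).symm, hB]

lemma IsPrimitiveVec.exists_mulVec_single_eq {ι : Type*} [Fintype ι] [DecidableEq ι] {u : ι → ℤ}
    (hu : IsPrimitiveVec u) {i₀ i₁ : ι} (hi : i₁ ≠ i₀) :
    ∃ γ : Matrix ι ι ℤ, γ.det = 1 ∧ γ.mulVec (Pi.single i₀ 1) = u := by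
  obtain ⟨b, hb⟩ := hu.exists_basis i₀
  set P := (Pi.basisFun ℤ ι).toMatrix b with hP
  have hcol : ∀ i, P i i₀ = u i := fun i => by simp [hP, Module.Basis.toMatrix_apply, hb]
  have hdet : IsUnit P.det := (Pi.basisFun ℤ ι).isUnit_det b
  obtain ⟨s, hs⟩ := hdet
  refine ⟨P * diagonal (Function.update 1 i₁ (s : ℤ)), ?_, ?_⟩
  · rw [det_mul, det_diagonal, Finset.prod_update_of_mem (Finset.mem_univ _), ← hs]
    simp [← Units.val_mul, Int.units_mul_self]
  · ext i
    simp [mul_diagonal, hcol, hi.symm]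

lemma stdE1Z_eq_single {m n : ℕ} (hm : 0 < m) :
    stdE1Z m n = Pi.single (Sum.inl ⟨0, hm⟩) 1 := by
  ext i
  rcases i with i | i
  · simp [stdE1Z, Pi.single_apply, Fin.ext_iff]
  · simp [stdE1Z]

lemma stdE1R_eq_cast (m n : ℕ) : stdE1R m n = fun i => (stdE1Z m n i : ℝ) := by
  ext i
  rcases i with i | i <;> simp [stdE1Z, stdE1R]

lemma isPrimitiveVec_stdE1Z {m : ℕ} (hm : 0 < m) (n : ℕ) : IsPrimitiveVec (stdE1Z m n) := by
  intro p hp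
  refine ⟨Sum.inl ⟨0, hm⟩, ?_⟩
  simpa [stdE1Z, Int.natCast_dvd] using hp.ne_one

/-- Corollary 4.7 of the paper: if `ψ : [1,∞) → (0,∞)` is non-increasing,
continuous, and `∫_1^∞ ψ = ∞`, then Haar-almost every `g ∈ SL_d(ℝ)` is
`γ`-congruence-`ψ`-approximable for every `γ ∈ SL_d(ℤ)`: there exist
`γ̃ ∈ Γ_N` making the `ℤ^n`-part `w` of `g γ γ̃ e₁` arbitrarily large in norm
while the `ℤ^m`-part `v` satisfies `‖v‖^m ≤ ψ(‖w‖^n)`. -/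
theorem almost_every_congruence_psi_approximable (m n : ℕ) (hm : 0 < m) (hn : 0 < n)
    (N : ℕ) (hN : 0 < N) (ψ : ℝ → ℝ)
    (hψpos : ∀ x ∈ Ici (1 : ℝ), 0 < ψ x)
    (hψanti : AntitoneOn ψ (Ici (1 : ℝ)))
    (hψcont : ContinuousOn ψ (Ici (1 : ℝ)))
    (hdiv : ∫⁻ x in Ici (1 : ℝ), ENNReal.ofReal (ψ x) = ⊤)
    (ν : Measure (Matrix.SpecialLinearGroup (Fin m ⊕ Fin n) ℝ))
    (hν : ν.IsHaarMeasure) :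
    ∀ᵐ g ∂ν, ∀ γ : Matrix (Fin m ⊕ Fin n) (Fin m ⊕ Fin n) ℤ, γ.det = 1 →
      ∀ M : ℝ, 0 < M →
        ∃ γt : Matrix (Fin m ⊕ Fin n) (Fin m ⊕ Fin n) ℤ, γt.det = 1 ∧
          (∀ i, γt.mulVec (stdE1Z m n) i ≡ stdE1Z m n i [ZMOD N]) ∧
          M < ‖(fun j : Fin n =>
            (g.1 * γ.map (Int.cast : ℤ → ℝ) * γt.map (Int.cast : ℤ → ℝ)).mulVec
              (stdE1R m n) (Sum.inr j))‖ ∧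
          ‖(fun j : Fin m =>
            (g.1 * γ.map (Int.cast : ℤ → ℝ) * γt.map (Int.cast : ℤ → ℝ)).mulVec
              (stdE1R m n) (Sum.inl j))‖ ^ m ≤
            ψ (‖(fun j : Fin n =>
              (g.1 * γ.map (Int.cast : ℤ → ℝ) * γt.map (Int.cast : ℤ → ℝ)).mulVec
                (stdE1R m n) (Sum.inr j))‖ ^ n) := by
  filter_upwards [ae_forall_isApproximable (N := N) hm hn hN hψpos hψanti hdiv ν]
    with g hg γ hγ M hM
  obtain ⟨u, hu, hmod, h1, h2⟩ := hg _ ((isPrimitiveVec_stdE1Z hm n).mulVec hγ) ⌈max M 1⌉₊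
  have hw := (Nat.le_ceil _).trans_lt h1
  obtain ⟨γt, hγt, hγtu⟩ := (hu.mulVec (det_adjugate_eq_one hγ)).exists_mulVec_single_eq
    (i₀ := Sum.inl ⟨0, hm⟩) (i₁ := Sum.inr ⟨0, hn⟩) Sum.inr_ne_inl
  rw [← stdE1Z_eq_single hm] at hγtu
  have hvec : (g.1 * γ.map (Int.cast : ℤ → ℝ) * γt.map (Int.cast : ℤ → ℝ)).mulVec (stdE1R m n) =
      g.1.mulVec (fun i => (u i : ℝ)) := by
    rw [stdE1R_eq_cast, ← mulVec_mulVec, ← mulVec_mulVec, map_intCast_mulVec, hγtu,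
      map_intCast_mulVec, mulVec_adjugate_mulVec hγ]
  rw [max_eq_left (one_le_pow₀ ((le_max_right M 1).trans hw.le))] at h2
  refine ⟨γt, hγt, fun i => ?_, ?_, ?_⟩
  · have := mulVec_modEq γ.adjugate hmod i
    rwa [adjugate_mulVec_mulVec hγ, ← hγtu] at this
  · rw [hvec]
    exact (le_max_left M 1).trans_lt hw
  · rw [hvec]
    exact h2
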